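/- arXiv:0807.2371 — 9 statements merged into one kernel-verified Lean document; each statement's English description precedes it below -/
import Mathlib

section
/- Let i+j ≤ n−1. Then the cone ℝ₊A generated by the exponent set A equals the intersection of the n+1 closed halfspaces determined by ν and the standard basis vectors; explicitly, ℝ₊A = { x ∈ ℝ^n : x_k ≥ 0 for every k ∈ [n], and −j(x_1+⋯+x_i) + (n−j)(x_{i+1}+⋯+x_n) ≥ 0 }. -/
/-- The set of all nonnegative real linear combinations of elements of `S ⊆ ℝ^n`. -/
def nonnegSpan {n : ℕ} (S : Set (Fin n → ℝ)) : Set (Fin n → ℝ) :=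
  { x | ∃ (m : ℕ) (c : Fin m → ℝ) (v : Fin m → (Fin n → ℝ)),
      (∀ l, 0 ≤ c l) ∧ (∀ l, v l ∈ S) ∧ x = ∑ l, c l • v l }

theorem sum_smul_mem_nonnegSpan {n : ℕ} {ι : Type*} {S : Set (Fin n → ℝ)} (s : Finset ι)
    (c : ι → ℝ) (v : ι → Fin n → ℝ) (hc : ∀ l ∈ s, 0 ≤ c l) (hv : ∀ l ∈ s, v l ∈ S) :
    ∑ l ∈ s, c l • v l ∈ nonnegSpan S := by
  refine ⟨s.card, fun l => c (s.equivFin.symm l), fun l => v (s.equivFin.symm l),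
    fun l => hc _ (s.equivFin.symm l).2, fun l => hv _ (s.equivFin.symm l).2, ?_⟩
  rw [Equiv.sum_comp s.equivFin.symm (fun l : s => c l • v l), Finset.sum_coe_sort s
    (fun l => c l • v l)]

theorem nonnegSpan_subset {n : ℕ} {S T : Set (Fin n → ℝ)} (hST : S ⊆ T) (h0 : 0 ∈ T)
    (hadd : ∀ x ∈ T, ∀ y ∈ T, x + y ∈ T) (hsmul : ∀ c : ℝ, 0 ≤ c → ∀ x ∈ T, c • x ∈ T) :
    nonnegSpan S ⊆ T := by
  rintro x ⟨m, c, v, hc, hv, rfl⟩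
  exact Finset.sum_induction _ (· ∈ T) (fun a b ha hb => hadd a ha b hb) h0
    fun l _ => hsmul _ (hc l) _ (hST (hv l))

theorem card_filter_fin_Ico {n i j : ℕ} (h : i + j ≤ n) :
    (Finset.univ.filter (fun k : Fin n => i ≤ k.val ∧ k.val < i + j)).card = j := by
  rw [← Finset.card_map Fin.valEmbedding]
  have : (Finset.univ.filter (fun k : Fin n => i ≤ k.val ∧ k.val < i + j)).map Fin.valEmbedding
      = Finset.Ico i (i + j) := by
    ext m
    simp only [Finset.mem_map, Finset.mem_filter, Finset.mem_univ, true_and, Finset.mem_Ico,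
      Fin.valEmbedding_apply]
    exact ⟨by rintro ⟨k, hk, rfl⟩; exact hk, fun hm => ⟨⟨m, by omega⟩, hm, rfl⟩⟩
  simp [this]

/-- The number of indices `k` at which the map equal to `b` on `[i, i + j)` and to `a` elsewhere
takes the value `m`. -/
theorem card_fiber_ite_Ico {n i j : ℕ} (h : i + j ≤ n) (a b m : Fin n) :
    ((Finset.univ.filter
      (fun k : Fin n => (if i ≤ k.val ∧ k.val < i + j then b else a) = m)).card : ℝ)
      = ((n : ℝ) - j) * (if a = m then 1 else 0) + j * (if b = m then 1 else 0) := by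
  have hcard := card_filter_fin_Ico h
  have hsum := Finset.card_filter_add_card_filter_not (s := (Finset.univ : Finset (Fin n)))
    (fun k : Fin n => i ≤ k.val ∧ k.val < i + j)
  rw [hcard, Finset.card_univ, Fintype.card_fin] at hsum
  have hnot : ((Finset.univ.filter
      (fun k : Fin n => ¬ (i ≤ k.val ∧ k.val < i + j))).card : ℝ) = n - j := by
    rw [eq_sub_iff_add_eq']; exact_mod_cast hsum
  rw [Finset.card_filter]
  push_cast
  have : ∀ k : Fin n, (if (if i ≤ k.val ∧ k.val < i + j then b else a) = m then (1 : ℝ) else 0)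
      = if i ≤ k.val ∧ k.val < i + j then (if b = m then 1 else 0)
        else (if a = m then 1 else 0) := fun k => by split_ifs <;> rfl
  simp_rw [this]
  rw [Finset.sum_ite, Finset.sum_const, Finset.sum_const, nsmul_eq_mul, nsmul_eq_mul, hcard, hnot]
  ring

theorem sum_card_fiber {α β : Type*} [Fintype α] [Fintype β] [DecidableEq β]
    (f : α → β) (p : β → Prop) [DecidablePred p] :
    ∑ m ∈ Finset.univ.filter p, ((Finset.univ.filter (fun k => f k = m)).card : ℝ)
      = ((Finset.univ.filter (fun k => p (f k))).card : ℝ) := by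
  rw [← Nat.cast_sum, Finset.card_eq_sum_card_fiberwise (f := f) (t := Finset.univ.filter p)
    (fun k hk => by simpa using hk)]
  congr 1
  refine Finset.sum_congr rfl fun m hm => ?_
  rw [Finset.filter_filter]
  congr 1
  ext k
  simp only [Finset.mem_filter, Finset.mem_univ, true_and] at hm ⊢
  exact ⟨fun h => ⟨h ▸ hm, h⟩, And.right⟩

/-- for `i + j ≤ n - 1`, the cone `ℝ₊A` generated by the exponent set `A`
of the transversal polymatroid presented by `𝒜 = {A_1, …, A_n}` (with `A_k = [n]` for
`k ∈ [i] ∪ ([n]∖[i+j])` and `A_k = [n]∖[i]` for `i+1 ≤ k ≤ i+j`; indices 0-based here)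
equals the intersection of the `n+1` halfspaces given by the standard basis vectors and
`ν = (-j,…,-j, n-j,…,n-j)`. -/
theorem cone_eq_halfspaces_of_add_le
    (n i j : ℕ) (hn : 3 ≤ n) (hi1 : 1 ≤ i) (hi2 : i ≤ n - 2)
    (hj1 : 1 ≤ j) (hj2 : j ≤ n - 1) (hij : i + j ≤ n - 1)
    (A : Set (Fin n → ℝ))
    (hA : A = { x | ∃ f : Fin n → Fin n,
        (∀ k : Fin n, (i ≤ k.val ∧ k.val < i + j) → i ≤ (f k).val) ∧
        ∀ m : Fin n, x m = ((Finset.univ.filter (fun k => f k = m)).card : ℝ) }) :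
    nonnegSpan A =
      { x : Fin n → ℝ | (∀ k, 0 ≤ x k) ∧
        0 ≤ -(j : ℝ) * (∑ k ∈ Finset.univ.filter (fun k : Fin n => k.val < i), x k)
            + ((n : ℝ) - j) * (∑ k ∈ Finset.univ.filter (fun k : Fin n => i ≤ k.val), x k) } := by
  have hn' : i + j ≤ n := by omega
  have hjn : (0 : ℝ) < (n : ℝ) - j := by
    have : (j : ℝ) < n := by exact_mod_cast (by omega : j < n)
    linarith
  have hnpos : (0 : ℝ) < n := by exact_mod_cast (by omega : 0 < n)
  have hnot : Finset.univ.filter (fun k : Fin n => ¬ k.val < i)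
      = Finset.univ.filter (fun k : Fin n => i ≤ k.val) := by simp only [not_lt]
  apply Set.Subset.antisymm
  · apply nonnegSpan_subset
    · rw [hA]
      rintro x ⟨f, hf, hx⟩
      refine ⟨fun k => by rw [hx]; positivity, ?_⟩
      simp_rw [hx]
      rw [sum_card_fiber f (fun m => m.val < i), sum_card_fiber f (fun m => i ≤ m.val)]
      have htotal := Finset.card_filter_add_card_filter_not
        (s := (Finset.univ : Finset (Fin n))) (fun k => (f k).val < i)
      simp only [not_lt, Finset.card_univ, Fintype.card_fin] at htotal
      have hle : j ≤ (Finset.univ.filter (fun k => i ≤ (f k).val)).card := by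
        rw [← card_filter_fin_Ico hn']
        exact Finset.card_le_card (Finset.monotone_filter_right _ fun k _ hk => hf k hk)
      have htotal' : ((Finset.univ.filter (fun k => (f k).val < i)).card : ℝ)
          = n - ((Finset.univ.filter (fun k => i ≤ (f k).val)).card : ℝ) := by
        rw [eq_sub_iff_add_eq]; exact_mod_cast htotal
      rw [htotal']
      have hle' := mul_nonneg hnpos.le (sub_nonneg.2 (Nat.cast_le (α := ℝ).2 hle))
      linarith
    · simp
    · rintro x ⟨hx, hx'⟩ y ⟨hy, hy'⟩
      refine ⟨fun k => add_nonneg (hx k) (hy k), ?_⟩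
      simp only [Pi.add_apply, Finset.sum_add_distrib]
      linarith
    · rintro c hc x ⟨hx, hx'⟩
      refine ⟨fun k => mul_nonneg hc (hx k), ?_⟩
      simp only [Pi.smul_apply, smul_eq_mul, ← Finset.mul_sum]
      linarith [mul_nonneg hc hx']
  · rintro x ⟨hx, hx'⟩
    set S := ∑ k ∈ Finset.univ.filter (fun k : Fin n => k.val < i), x k with hS
    set L := ∑ k ∈ Finset.univ.filter (fun k : Fin n => i ≤ k.val), x k with hL
    have hS0 : 0 ≤ S := Finset.sum_nonneg fun k _ => hx k
    have hL0 : 0 ≤ L := Finset.sum_nonneg fun k _ => hx k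
    have hj : (0 : ℝ) < j := by exact_mod_cast hj1
    rcases hL0.eq_or_lt with hLz | hLpos
    · have hSz : S = 0 := by
        rw [← hLz] at hx'
        nlinarith
      have hxz : x = 0 := by
        have hall : ∑ k, x k = 0 := by
          rw [← Finset.sum_filter_add_sum_filter_not Finset.univ (fun k : Fin n => k.val < i),
            hnot, ← hS, ← hL, hSz, ← hLz, add_zero]
        ext k
        exact (Finset.sum_eq_zero_iff_of_nonneg fun k _ => hx k).1 hall k (Finset.mem_univ k)
      rw [hxz]
      simpa using sum_smul_mem_nonnegSpan (S := A) (∅ : Finset ℕ) 0 0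
    -- `y` solves `(n - j) y_a + j x_a [i ≤ a] (∑ y) / L = x_a`.
    · set t : ℝ := (1 - j * S / ((n - j) * L)) / n with ht
      have ht0 : 0 ≤ t := by
        refine div_nonneg (sub_nonneg.2 ((div_le_one (by positivity)).2 ?_)) hnpos.le
        linarith
      set y : Fin n → ℝ := fun a => if a.val < i then x a / (n - j) else x a * t with hy
      have hy0 : ∀ a, 0 ≤ y a := fun a => by
        simp only [hy]
        split_ifs
        · exact div_nonneg (hx a) hjn.le
        · exact mul_nonneg (hx a) ht0
      have hysum : ∑ a, y a = S / (n - j) + L * t := by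
        simp only [hy]
        rw [Finset.sum_ite, hnot, ← Finset.sum_div, ← Finset.sum_mul]
      have hxeq : x = ∑ p ∈ Finset.univ ×ˢ Finset.univ.filter (fun b : Fin n => i ≤ b.val),
          (y p.1 * (x p.2 / L)) • (fun m : Fin n => ((n : ℝ) - j) * (if p.1 = m then 1 else 0)
            + j * (if p.2 = m then 1 else 0)) := by
        ext m
        rw [Finset.sum_apply, Finset.sum_product]
        have hinner : ∀ a, ∑ b ∈ Finset.univ.filter (fun b : Fin n => i ≤ b.val),
            ((y a * (x b / L)) • (fun m : Fin n => ((n : ℝ) - j) * (if a = m then 1 else 0)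
              + j * (if b = m then 1 else 0))) m
            = (if a = m then y a * (n - j) else 0)
              + y a * (if i ≤ m.val then j * (x m / L) else 0) := fun a => by
          have hdist : ∀ b, ((y a * (x b / L)) •
              (fun m : Fin n => ((n : ℝ) - j) * (if a = m then 1 else 0)
                + j * (if b = m then 1 else 0))) m
              = (y a * ((n - j) * (if a = m then 1 else 0)) / L) * x b
                + y a * (if b = m then j * (x b / L) else 0) := fun b => by
            simp only [Pi.smul_apply, smul_eq_mul]
            split_ifs <;> ring
          simp_rw [hdist]
          rw [Finset.sum_add_distrib, ← Finset.mul_sum, ← Finset.mul_sum, ← hL,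
            div_mul_cancel₀ _ hLpos.ne', Finset.sum_ite_eq']
          simp only [Finset.mem_filter, Finset.mem_univ, true_and]
          congr 1
          split_ifs <;> ring
        simp_rw [hinner]
        rw [Finset.sum_add_distrib, ← Finset.sum_mul, hysum, Finset.sum_ite_eq']
        simp only [Finset.mem_univ, if_true, hy]
        rcases lt_or_ge m.val i with hm | hm
        · rw [if_pos hm, if_neg hm.not_ge]
          field_simp
          ring
        · rw [if_neg hm.not_gt, if_pos hm, ht]
          field_simp
          ring
      rw [hxeq]
      refine sum_smul_mem_nonnegSpan _ _ _
        (fun p _ => mul_nonneg (hy0 _) (div_nonneg (hx _) hL0)) fun p hp => ?_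
      rw [hA]
      refine ⟨fun k => if i ≤ k.val ∧ k.val < i + j then p.2 else p.1, fun k hk => ?_,
        fun m => (card_fiber_ite_Ico hn' p.1 p.2 m).symm⟩
      beta_reduce
      rw [if_pos hk]
      simpa using hp
end

section
/- The representation of the cone C = { x ∈ ℝ^n : x_k ≥ 0 for every k ∈ [n], and ⟨x,ν⟩ ≥ 0 } as an intersection of the n+1 halfspaces H⁺_a, a ∈ N = {ν, e_1, …, e_n}, is irreducible: for every a ∈ N there exists x ∈ ℝ^n with ⟨x,b⟩ ≥ 0 for all b ∈ N∖{a} but ⟨x,a⟩ < 0; in particular no halfspace in the representation can be omitted. -/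
/-- The usual inner product on `ℝ^n`. -/
def dotProd {n : ℕ} (x y : Fin n → ℝ) : ℝ := ∑ k, x k * y k

theorem dotProd_single {n : ℕ} (k : Fin n) (c : ℝ) (y : Fin n → ℝ) :
    dotProd (Pi.single k c) y = c * y k :=
  single_dotProduct y c k

theorem dotProd_sub {n : ℕ} (x z y : Fin n → ℝ) :
    dotProd (x - z) y = dotProd x y - dotProd z y :=
  sub_dotProduct x z y

/-- the representation of the cone
`C = {x : x_k ≥ 0 ∀k, ⟨x,ν⟩ ≥ 0}` as the intersection of the `n+1` halfspaces
`H⁺_a`, `a ∈ N = {ν, e_1, …, e_n}`, is irreducible: for every `a ∈ N` there is an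
`x` satisfying all the other halfspace inequalities but violating the one for `a`. -/
theorem representation_irreducible
    (n i j : ℕ) (hn : 3 ≤ n) (hi1 : 1 ≤ i) (hi2 : i ≤ n - 2)
    (hj1 : 1 ≤ j) (hj2 : j ≤ n - 1)
    (ν : Fin n → ℝ) (hν : ∀ k : Fin n, ν k = if k.val < i then -(j : ℝ) else (n : ℝ) - j)
    (N : Set (Fin n → ℝ))
    (hN : N = insert ν (Set.range (fun k : Fin n => (fun m => if m = k then (1 : ℝ) else 0)))) :
    ∀ a ∈ N, ∃ x : Fin n → ℝ, (∀ b ∈ N \ {a}, 0 ≤ dotProd x b) ∧ dotProd x a < 0 := by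
  have hj : (1 : ℝ) ≤ j := by exact_mod_cast hj1
  have hjn : (j : ℝ) ≤ n := by exact_mod_cast (by omega : j ≤ n)
  subst hN
  rintro a (rfl | ⟨k, rfl⟩)
  · refine ⟨Pi.single ⟨0, by omega⟩ 1, ?_, ?_⟩
    · rintro b ⟨rfl | ⟨m, rfl⟩, hb⟩
      · exact absurd rfl hb
      · rw [dotProd_single]
        dsimp only
        split_ifs <;> norm_num
    · rw [dotProd_single, hν, if_pos (show 0 < i by omega)]
      linarith
  · obtain ⟨l, hl, hlk⟩ : ∃ l : Fin n, i ≤ l.val ∧ l ≠ k := by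
      by_cases hk : k.val = i
      · exact ⟨⟨i + 1, by omega⟩, by simp, by simp [Fin.ext_iff, hk]⟩
      · exact ⟨⟨i, by omega⟩, le_rfl, fun h => hk (by simp [← h])⟩
    refine ⟨Pi.single l 1 - Pi.single k 1, ?_, ?_⟩
    · rintro b ⟨rfl | ⟨m, rfl⟩, hb⟩
      · rw [dotProd_sub, dotProd_single, dotProd_single, hν l, hν k, if_neg (by omega)]
        split_ifs <;> linarith
      · have hkm : k ≠ m := by
          rintro rfl
          exact hb rfl
        rw [dotProd_sub, dotProd_single, dotProd_single]
        dsimp only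
        rw [if_neg hkm]
        split_ifs <;> norm_num
    · rw [dotProd_sub, dotProd_single, dotProd_single]
      simp [hlk]
end

section
/- Let t ≥ 1 and let S = σ^t[i] = {σ^t(1),…,σ^t(i)}, where σ is the cyclic permutation (1,2,…,n) of [n]. Then the cone ℝ₊A′ generated by the exponent set A′ equals { x ∈ ℝ^n : x_k ≥ 0 for every k ∈ [n], and −j·Σ_{k∈S} x_k + (n−j)·Σ_{k∉S} x_k ≥ 0 }, and this representation as an intersection of the n+1 halfspaces with normal vectors ν^j_S and e_1,…,e_n is irreducible. -/
open scoped Classical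

theorem zero_mem_nonnegSpan {n : ℕ} (A : Set (Fin n → ℝ)) : 0 ∈ nonnegSpan A :=
  ⟨0, Fin.elim0, Fin.elim0, fun l => l.elim0, fun l => l.elim0, by simp⟩

theorem add_mem_nonnegSpan {n : ℕ} {A : Set (Fin n → ℝ)} {x y : Fin n → ℝ}
    (hx : x ∈ nonnegSpan A) (hy : y ∈ nonnegSpan A) : x + y ∈ nonnegSpan A := by
  obtain ⟨m, c, v, hc, hv, rfl⟩ := hx
  obtain ⟨m', c', v', hc', hv', rfl⟩ := hy
  refine ⟨m + m', Fin.append c c', Fin.append v v', fun l => ?_, fun l => ?_, ?_⟩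
  · refine Fin.addCases (fun l => ?_) (fun l => ?_) l
    · simpa using hc l
    · simpa using hc' l
  · refine Fin.addCases (fun l => ?_) (fun l => ?_) l
    · simpa using hv l
    · simpa using hv' l
  · simp [Fin.sum_univ_add]

theorem smul_mem_nonnegSpan {n : ℕ} {A : Set (Fin n → ℝ)} {c : ℝ} {v : Fin n → ℝ}
    (hc : 0 ≤ c) (hv : v ∈ A) : c • v ∈ nonnegSpan A :=
  ⟨1, fun _ => c, fun _ => v, fun _ => hc, fun _ => hv, by simp⟩

theorem sum_mem_nonnegSpan {n : ℕ} {A : Set (Fin n → ℝ)} {ι : Type*} (s : Finset ι)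
    (f : ι → Fin n → ℝ) (h : ∀ a ∈ s, f a ∈ nonnegSpan A) : ∑ a ∈ s, f a ∈ nonnegSpan A :=
  Finset.sum_induction f (· ∈ nonnegSpan A) (fun _ _ => add_mem_nonnegSpan)
    (zero_mem_nonnegSpan A) h

/-- A nonnegative vector whose mass on `S` is at most `(n - j) / j` times its mass off `S` is a
nonnegative combination of the vectors `j e_a + (n - j) e_b` with `a ∉ S`. -/
theorem mem_nonnegSpan_of_weighted_sum_nonneg {n j : ℕ} (hj0 : 0 < j) (hj : j < n)
    (S : Set (Fin n)) (A : Set (Fin n → ℝ))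
    (hA : ∀ a b : Fin n, a ∉ S →
      (j : ℝ) • Pi.single a (1 : ℝ) + ((n : ℝ) - j) • Pi.single b (1 : ℝ) ∈ A)
    (x : Fin n → ℝ) (hx : ∀ k, 0 ≤ x k)
    (h : 0 ≤ -(j : ℝ) * (∑ k ∈ Finset.univ.filter (fun k : Fin n => k ∈ S), x k)
        + ((n : ℝ) - j) * (∑ k ∈ Finset.univ.filter (fun k : Fin n => k ∉ S), x k)) :
    x ∈ nonnegSpan A := by
  set X := ∑ k ∈ Finset.univ.filter (fun k : Fin n => k ∈ S), x k with hX
  set Y := ∑ k ∈ Finset.univ.filter (fun k : Fin n => k ∉ S), x k with hY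
  have hjn : (0 : ℝ) < (n : ℝ) - j := sub_pos.2 (by exact_mod_cast hj)
  have hn : (0 : ℝ) < n := by have : (0 : ℝ) ≤ j := j.cast_nonneg; linarith
  have hY0 : 0 ≤ Y := Finset.sum_nonneg fun k _ => hx k
  rcases hY0.eq_or_lt with hY0 | hYpos
  · have hX0 : X = 0 := by
      have hXn : 0 ≤ X := Finset.sum_nonneg fun k _ => hx k
      have hjX : (j : ℝ) * X ≤ 0 := by rw [← hY0] at h; linarith
      have hjR : (0 : ℝ) < j := by exact_mod_cast hj0
      nlinarith
    have hx0 : x = 0 := by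
      funext k
      by_cases hk : k ∈ S
      · exact (Finset.sum_eq_zero_iff_of_nonneg fun k _ => hx k).1 hX0 k (by simpa using hk)
      · exact (Finset.sum_eq_zero_iff_of_nonneg fun k _ => hx k).1 hY0.symm k (by simpa using hk)
    rw [hx0]
    exact zero_mem_nonnegSpan A
  set r := j * X / ((n - j) * Y) with hr
  have hr1 : r ≤ 1 := by
    rw [hr, div_le_one (by positivity)]
    linarith
  have key : x = ∑ a ∈ Finset.univ.filter (fun k : Fin n => k ∉ S),
      (∑ b ∈ Finset.univ.filter (fun k : Fin n => k ∈ S),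
        (x a * x b / ((n - j) * Y)) •
          ((j : ℝ) • Pi.single a (1 : ℝ) + ((n : ℝ) - j) • Pi.single b (1 : ℝ)) +
        (x a * (1 - r) / n) •
          ((j : ℝ) • Pi.single a (1 : ℝ) + ((n : ℝ) - j) • Pi.single a (1 : ℝ))) := by
    funext m
    simp only [Finset.sum_apply, Pi.add_apply, Pi.smul_apply, smul_eq_mul, Pi.single_apply]
    have inner : ∀ a, (∑ b ∈ Finset.univ.filter (fun k : Fin n => k ∈ S),
        x a * x b / ((n - j) * Y) *
          (j * (if m = a then (1 : ℝ) else 0) + (n - j) * (if m = b then (1 : ℝ) else 0))) +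
        x a * (1 - r) / n *
          (j * (if m = a then (1 : ℝ) else 0) + (n - j) * (if m = a then (1 : ℝ) else 0)) =
        (if m = a then x a else 0) + x a * ((if m ∈ S then x m else 0) / Y) := by
      intro a
      have h1 : ∑ b ∈ Finset.univ.filter (fun k : Fin n => k ∈ S),
          x b * (if m = b then (1 : ℝ) else 0) = if m ∈ S then x m else 0 := by
        simp [Finset.sum_ite_eq]
      have h2 : ∑ b ∈ Finset.univ.filter (fun k : Fin n => k ∈ S),
          x a * x b / ((n - j) * Y) *
            (j * (if m = a then (1 : ℝ) else 0) + (n - j) * (if m = b then (1 : ℝ) else 0)) =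
          x a * (if m = a then (1 : ℝ) else 0) * r + x a * ((if m ∈ S then x m else 0) / Y) := by
        trans ∑ b ∈ Finset.univ.filter (fun k : Fin n => k ∈ S),
          (x b * (x a * (if m = a then (1 : ℝ) else 0) * j / ((n - j) * Y)) +
            x b * (if m = b then (1 : ℝ) else 0) * (x a / Y))
        · refine Finset.sum_congr rfl fun b _ => ?_
          field_simp
        · rw [Finset.sum_add_distrib, ← Finset.sum_mul, ← Finset.sum_mul, h1, ← hX, hr]
          ring
      rw [h2]
      split_ifs <;> field_simp <;> ring
    rw [Finset.sum_congr rfl fun a _ => inner a, Finset.sum_add_distrib, ← Finset.sum_mul, ← hY,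
      mul_div_cancel₀ _ hYpos.ne']
    by_cases hm : m ∈ S <;> simp [hm]
  rw [key]
  refine sum_mem_nonnegSpan _ _ fun a ha => add_mem_nonnegSpan
    (sum_mem_nonnegSpan _ _ fun b _ => smul_mem_nonnegSpan ?_ (hA a b (by simpa using ha)))
    (smul_mem_nonnegSpan ?_ (hA a a (by simpa using ha)))
  · exact div_nonneg (mul_nonneg (hx a) (hx b)) (by positivity)
  · exact div_nonneg (mul_nonneg (hx a) (by linarith)) hn.le

theorem injective_add_mod {n : ℕ} (hn : 0 < n) (t : ℕ) :
    Function.Injective fun k : Fin n => (⟨(k.val + t) % n, Nat.mod_lt _ hn⟩ : Fin n) := by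
  intro a b hab
  have h : a.val + t ≡ b.val + t [MOD n] := Fin.mk.inj hab
  exact Fin.ext ((Nat.ModEq.add_right_cancel' t h).eq_of_lt_of_lt a.2 b.2)

theorem card_filter_cyclic_interval {n i j : ℕ} (hi : i ≤ n) (hj : j ≤ n) :
    (Finset.univ.filter fun k : Fin n =>
      (i + j ≤ n - 1 ∧ i ≤ k.val ∧ k.val < i + j) ∨
        (n ≤ i + j ∧ (k.val + n < i + j ∨ i ≤ k.val))).card = j := by
  rw [← Finset.card_map Fin.valEmbedding]
  rcases le_or_gt n (i + j) with h | h
  · trans (Finset.range n \ Finset.Ico (i + j - n) i).card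
    · congr 1
      ext k
      simp only [Finset.mem_map, Finset.mem_filter, Finset.mem_univ, true_and,
        Fin.valEmbedding_apply, Finset.mem_sdiff, Finset.mem_range, Finset.mem_Ico]
      constructor
      · rintro ⟨a, ha, rfl⟩
        have := a.2
        omega
      · intro hk
        exact ⟨⟨k, hk.1⟩, by simp only; omega, rfl⟩
    · rw [Finset.card_sdiff_of_subset, Finset.card_range, Nat.card_Ico]
      · omega
      · intro k
        simp only [Finset.mem_range, Finset.mem_Ico]
        omega
  · trans (Finset.Ico i (i + j)).card
    · congr 1
      ext k
      simp only [Finset.mem_map, Finset.mem_filter, Finset.mem_univ, true_and,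
        Fin.valEmbedding_apply, Finset.mem_Ico]
      constructor
      · rintro ⟨a, ha, rfl⟩
        omega
      · intro hk
        exact ⟨⟨k, by omega⟩, by simp only; omega, rfl⟩
    · simp

theorem sum_mul_card_fiber {n : ℕ} (w : Fin n → ℝ) (f : Fin n → Fin n) :
    ∑ m, ((Finset.univ.filter fun k => f k = m).card : ℝ) * w m = ∑ k, w (f k) := by
  rw [← Finset.sum_fiberwise Finset.univ f fun k => w (f k)]
  refine Finset.sum_congr rfl fun m _ => ?_
  rw [Finset.sum_congr rfl fun k hk => congrArg w (Finset.mem_filter.1 hk).2, Finset.sum_const,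
    nsmul_eq_mul]

theorem dotProd_eq_weighted_sum {n : ℕ} (S : Set (Fin n)) (p q : ℝ) (ν x : Fin n → ℝ)
    (hν : ∀ k, ν k = if k ∈ S then p else q) :
    dotProd x ν = p * (∑ k ∈ Finset.univ.filter (fun k : Fin n => k ∈ S), x k)
      + q * (∑ k ∈ Finset.univ.filter (fun k : Fin n => k ∉ S), x k) := by
  unfold dotProd
  rw [← Finset.sum_filter_add_sum_filter_not Finset.univ (fun k : Fin n => k ∈ S),
    Finset.mul_sum, Finset.mul_sum]
  congr 1 <;>
  · refine Finset.sum_congr rfl fun k hk => ?_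
    have := (Finset.mem_filter.1 hk).2
    simp [hν, this, mul_comm]

theorem dotProd_nonneg_of_mem_nonnegSpan {n : ℕ} {A : Set (Fin n → ℝ)} {w x : Fin n → ℝ}
    (hA : ∀ v ∈ A, 0 ≤ dotProd v w) (hx : x ∈ nonnegSpan A) : 0 ≤ dotProd x w := by
  obtain ⟨m, c, v, hc, hv, rfl⟩ := hx
  have : dotProd (∑ l, c l • v l) w = ∑ l, c l * dotProd (v l) w := by
    simp only [dotProd, Finset.sum_apply, Pi.smul_apply, smul_eq_mul, Finset.sum_mul,
      Finset.mul_sum, mul_assoc]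
    exact Finset.sum_comm
  rw [this]
  exact Finset.sum_nonneg fun l _ => mul_nonneg (hc l) (hA _ (hv l))

theorem dotProd_indicator {n : ℕ} (x : Fin n → ℝ) (k : Fin n) :
    dotProd x (fun m => if m = k then (1 : ℝ) else 0) = x k := by
  simp [dotProd]

theorem irreducible_of_sign_pattern {n : ℕ} (ν : Fin n → ℝ) (hneg : ∃ s, ν s < 0)
    (hpos : ∀ k, 0 < ν k → ∃ k', k' ≠ k ∧ ν k ≤ ν k')
    (a : Fin n → ℝ)
    (ha : a ∈ insert ν (Set.range fun k : Fin n => (fun m => if m = k then (1 : ℝ) else 0))) :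
    ∃ x : Fin n → ℝ,
      (∀ b ∈ insert ν (Set.range fun k : Fin n => (fun m => if m = k then (1 : ℝ) else 0)) \ {a},
        0 ≤ dotProd x b) ∧ dotProd x a < 0 := by
  rcases ha with rfl | ⟨k, rfl⟩
  · obtain ⟨s, hs⟩ := hneg
    refine ⟨Pi.single s 1, ?_, by simpa [dotProd, Pi.single_apply] using hs⟩
    rintro b ⟨rfl | ⟨l, rfl⟩, hb⟩
    · exact absurd rfl hb
    · rw [dotProd_indicator, Pi.single_apply]
      split_ifs <;> norm_num
  · rcases le_or_gt (ν k) 0 with hk | hk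
    · refine ⟨Pi.single k (-1), ?_, by rw [dotProd_indicator]; simp⟩
      rintro b ⟨rfl | ⟨l, rfl⟩, hb⟩
      · simpa [dotProd, Pi.single_apply] using hk
      · have hlk : l ≠ k := by rintro rfl; exact hb rfl
        rw [dotProd_indicator, Pi.single_eq_of_ne hlk]
    · obtain ⟨k', hk', hle⟩ := hpos k hk
      refine ⟨Pi.single k' 1 - Pi.single k 1, ?_, ?_⟩
      · rintro b ⟨rfl | ⟨l, rfl⟩, hb⟩
        · simpa [dotProd, Pi.single_apply, sub_mul, Finset.sum_sub_distrib] using hle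
        · have hlk : l ≠ k := by rintro rfl; exact hb rfl
          rw [dotProd_indicator, Pi.sub_apply, Pi.single_eq_of_ne hlk, Pi.single_apply]
          split_ifs <;> norm_num
      · rw [dotProd_indicator]
        simp [hk'.symm]

/-- for `t ≥ 1` and `S = σ^t[i]` (where `σ = (1,2,…,n)`, so in 0-based
indexing `S = {(m + t) % n : m < i}`), the cone `ℝ₊A'` generated by the exponent set
`A'` of the transversal polymatroid presented by `ℬ = {B_1,…,B_n}` (with
`B_{σ^t(k)} = [n]∖S` for the indices `k` with `i+1 ≤ k ≤ i+j` when `i+j ≤ n-1`,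
resp. `k ∈ [i+j-n] ∪ ([n]∖[i])` when `i+j ≥ n`, and `B_{σ^t(k)} = [n]` otherwise;
indices 0-based here) equals
`{x : x_k ≥ 0 ∀ k, -j·Σ_{k∈S} x_k + (n-j)·Σ_{k∉S} x_k ≥ 0}`, and this representation
by the `n+1` halfspaces with normal vectors `ν^j_S, e_1, …, e_n` is irreducible. -/
theorem cone_eq_halfspaces_shifted_and_irreducible
    (n i j t : ℕ) (hn : 3 ≤ n) (hi1 : 1 ≤ i) (hi2 : i ≤ n - 2)
    (hj1 : 1 ≤ j) (hj2 : j ≤ n - 1) (ht : 1 ≤ t)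
    (S : Set (Fin n)) (hS : S = { k : Fin n | ∃ m, m < i ∧ k.val = (m + t) % n })
    (νS : Fin n → ℝ) (hνS : ∀ k : Fin n, νS k = if k ∈ S then -(j : ℝ) else (n : ℝ) - j)
    (A' : Set (Fin n → ℝ))
    (hA' : A' = { x | ∃ f : Fin n → Fin n,
        (∀ k l : Fin n, l.val = (k.val + t) % n →
          ((i + j ≤ n - 1 ∧ i ≤ k.val ∧ k.val < i + j) ∨
            (n ≤ i + j ∧ (k.val + n < i + j ∨ i ≤ k.val))) → f l ∉ S) ∧
        ∀ m : Fin n, x m = ((Finset.univ.filter (fun k => f k = m)).card : ℝ) })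
    (N : Set (Fin n → ℝ))
    (hN : N = insert νS (Set.range (fun k : Fin n => (fun m => if m = k then (1 : ℝ) else 0)))) :
    nonnegSpan A' =
      { x : Fin n → ℝ | (∀ k, 0 ≤ x k) ∧
        0 ≤ -(j : ℝ) * (∑ k ∈ Finset.univ.filter (fun k : Fin n => k ∈ S), x k)
            + ((n : ℝ) - j) * (∑ k ∈ Finset.univ.filter (fun k : Fin n => k ∉ S), x k) } ∧
    (∀ a ∈ N, ∃ x : Fin n → ℝ, (∀ b ∈ N \ {a}, 0 ≤ dotProd x b) ∧ dotProd x a < 0) := by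
  have hn0 : 0 < n := by omega
  let e : Fin n ≃ Fin n := Equiv.ofBijective _
    (Finite.injective_iff_bijective.1 (injective_add_mod hn0 t))
  have he_val : ∀ k, (e k).val = (k.val + t) % n := fun k => rfl
  set P : Fin n → Prop := fun k => (i + j ≤ n - 1 ∧ i ≤ k.val ∧ k.val < i + j) ∨
            (n ≤ i + j ∧ (k.val + n < i + j ∨ i ≤ k.val))
  have hPcard : (Finset.univ.filter P).card = j :=
    card_filter_cyclic_interval (by omega) (by omega)
  have hSe : ∀ k, e k ∈ S ↔ k.val < i := by
    intro k
    rw [hS]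
    constructor
    · rintro ⟨m, hm, h⟩
      have : e k = e ⟨m, by omega⟩ := Fin.ext h
      simpa [e.injective this] using hm
    · exact fun h => ⟨k.val, h, rfl⟩
  have hjn : (0 : ℝ) < (n : ℝ) - j := sub_pos.2 (by exact_mod_cast (by omega : j < n))
  have hj0 : (0 : ℝ) < j := by exact_mod_cast hj1
  have hform := fun x => dotProd_eq_weighted_sum S (-(j : ℝ)) ((n : ℝ) - j) νS x hνS
  refine ⟨Set.Subset.antisymm (fun x hx => ⟨fun k => ?_, ?_⟩) ?_, ?_⟩
  · rw [← dotProd_indicator x k]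
    refine dotProd_nonneg_of_mem_nonnegSpan (fun v hv => ?_) hx
    rw [hA'] at hv
    obtain ⟨f, -, hf⟩ := hv
    rw [dotProd_indicator, hf]
    positivity
  · rw [← hform]
    refine dotProd_nonneg_of_mem_nonnegSpan (fun v hv => ?_) hx
    rw [hA'] at hv
    obtain ⟨f, hfS, hf⟩ := hv
    have hle : (j : ℝ) ≤ ∑ k, if P k then (1 : ℝ) else 0 := by
      rw [Finset.sum_boole, hPcard]
    have hterm : ∀ k, (n : ℝ) * (if P k then (1 : ℝ) else 0) - j ≤ νS (f (e k)) := by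
      intro k
      rw [hνS]
      by_cases hk : P k
      · simp [hk, hfS k (e k) (he_val k) hk]
      · split_ifs <;> simp
    calc (0 : ℝ) ≤ ∑ k, ((n : ℝ) * (if P k then (1 : ℝ) else 0) - j) := by
          rw [Finset.sum_sub_distrib, ← Finset.mul_sum]
          simpa using mul_le_mul_of_nonneg_left hle n.cast_nonneg
      _ ≤ ∑ k, νS (f (e k)) := Finset.sum_le_sum fun k _ => hterm k
      _ = dotProd v νS := by
          rw [e.sum_comp (fun k => νS (f k)), ← sum_mul_card_fiber]
          simp only [dotProd, hf]
  · rintro x ⟨hx, h⟩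
    refine mem_nonnegSpan_of_weighted_sum_nonneg hj1 (by omega) S A' (fun a b ha => ?_) x hx h
    rw [hA']
    refine ⟨fun l => if P (e.symm l) then a else b, fun k l hl hk => ?_, fun m => ?_⟩
    · have : e k = l := Fin.ext ((he_val k).trans hl.symm)
      subst this
      simpa [show P k from hk] using ha
    · rw [← Finset.sum_boole,
        ← e.sum_comp (fun l => if (if P (e.symm l) then a else b) = m then (1 : ℝ) else 0)]
      simp only [Equiv.symm_apply_apply]
      have hs : ∀ k, (if (if P k then a else b) = m then (1 : ℝ) else 0) =
          (if P k then (1 : ℝ) else 0) * (Pi.single a (1 : ℝ) : Fin n → ℝ) m +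
          (1 - if P k then (1 : ℝ) else 0) * (Pi.single b (1 : ℝ) : Fin n → ℝ) m := by
        intro k
        by_cases hk : P k <;> simp [hk, Pi.single_apply, eq_comm]
      rw [Finset.sum_congr rfl fun k _ => hs k, Finset.sum_add_distrib, ← Finset.sum_mul,
        ← Finset.sum_mul, Finset.sum_sub_distrib, Finset.sum_boole, hPcard]
      simp
  · rw [hN]
    refine irreducible_of_sign_pattern νS ⟨e ⟨0, hn0⟩, ?_⟩ fun k hk => ?_
    · rw [hνS, if_pos ((hSe ⟨0, hn0⟩).2 hi1)]
      linarith
    · obtain ⟨k', hk'S, hk'⟩ : ∃ k', k' ∉ S ∧ k' ≠ k := by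
        by_cases hc : e ⟨n - 1, by omega⟩ = k
        · refine ⟨e ⟨n - 2, by omega⟩, ?_, ?_⟩
          · rw [hSe]; simpa using hi2
          · rw [← hc]
            intro h
            have := congrArg Fin.val (e.injective h)
            simp at this
            omega
        · refine ⟨_, ?_, hc⟩
          rw [hSe]
          simp
          omega
      refine ⟨k', hk', ?_⟩
      rw [hνS, hνS, if_neg hk'S]
      split_ifs <;> linarith
end

section
/- Let C be the n×n matrix whose rows are the vectors J_k = (n−j)e_k + j·e_{i+1} for 1 ≤ k ≤ i, J_r = (n−j)e_1 + j·e_r for i+2 ≤ r ≤ n, and J = n·e_n. Then |det(C)| = n·(n−j)^i·j^{n−i−1}; in particular these n vectors are linearly independent, so the cone they generate (and hence ℝ₊A) has dimension n. -/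
/-- A determinant whose Leibniz expansion has at most one nonzero term, the one of `τ`. -/
theorem Matrix.abs_det_eq_abs_prod_of_unique_perm {ι : Type*} [Fintype ι] [DecidableEq ι]
    (M : Matrix ι ι ℝ) (τ : Equiv.Perm ι)
    (h : ∀ σ : Equiv.Perm ι, (∀ k, M k (σ k) ≠ 0) → σ = τ) :
    |M.det| = |∏ k, M k (τ k)| := by
  rw [← Matrix.det_transpose, Matrix.det_apply', Finset.sum_eq_single τ]
  · simp only [Matrix.transpose_apply, abs_mul]
    rcases Int.units_eq_one_or (Equiv.Perm.sign τ) with hs | hs <;> simp [hs]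
  · intro σ _ hσ
    by_contra hne
    refine hσ (h σ fun k hk => hne ?_)
    rw [Finset.prod_eq_zero (Finset.mem_univ k) (by simpa using hk), mul_zero]
  · simp


/-- the matrix `C` whose rows are
`J_k = (n-j)e_k + j·e_{i+1}` for `1 ≤ k ≤ i`, `J_r = (n-j)e_1 + j·e_r` for
`i+2 ≤ r ≤ n`, and `J = n·e_n` (written in 0-based indexing below) has
`|det C| = n·(n-j)^i·j^(n-i-1)`; in particular its rows are linearly independent,
so they span `ℝ^n` and the cone they generate (hence `ℝ₊A`) has dimension `n`. -/
theorem abs_det_rows_eq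
    (n i j : ℕ) (hn : 3 ≤ n) (hi1 : 1 ≤ i) (hi2 : i ≤ n - 2)
    (hj1 : 1 ≤ j) (hj2 : j ≤ n - 1)
    (C : Matrix (Fin n) (Fin n) ℝ)
    (hC : ∀ k m : Fin n,
      C k m =
        if k.val < i then
          (if m = k then (n : ℝ) - j else 0) + (if m.val = i then (j : ℝ) else 0)
        else if k.val < n - 1 then
          (if m.val = 0 then (n : ℝ) - j else 0) + (if m.val = k.val + 1 then (j : ℝ) else 0)
        else
          (if m.val = n - 1 then (n : ℝ) else 0)) :
    |C.det| = (n : ℝ) * ((n : ℝ) - j) ^ i * (j : ℝ) ^ (n - i - 1) ∧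
    LinearIndependent ℝ (fun k : Fin n => C k) ∧
    Submodule.span ℝ (Set.range (fun k : Fin n => C k)) = ⊤ := by
  have hj : (0 : ℝ) < j := by exact_mod_cast hj1
  have hnj : (0 : ℝ) < (n : ℝ) - j := by
    rw [sub_pos]
    exact_mod_cast (by omega : j < n)
  have hn0 : (0 : ℝ) < n := by exact_mod_cast (by omega : 0 < n)
  have hdet : |C.det| = (n : ℝ) * ((n : ℝ) - j) ^ i * (j : ℝ) ^ (n - i - 1) := by
    let f : Fin n → Fin n := fun k =>
      if k.val = 0 then ⟨i, by omega⟩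
      else if k.val < i then k
      else if h : k.val < n - 2 then ⟨k.val + 1, by omega⟩
      else if k.val = n - 2 then ⟨0, by omega⟩
      else k
    have hfv : ∀ k, (f k).val = if k.val = 0 then i else if k.val < i then k.val
        else if k.val < n - 2 then k.val + 1 else if k.val = n - 2 then 0 else k.val := by
      intro k
      simp only [f]
      split_ifs <;> rfl
    have hf : Function.Injective f := by
      intro a b hab
      have h := congrArg Fin.val hab
      rw [hfv, hfv] at h
      ext
      split_ifs at h <;> omega
    let τ : Equiv.Perm (Fin n) := Equiv.ofBijective f (Finite.injective_iff_bijective.mp hf)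
    have hτ : ∀ σ : Equiv.Perm (Fin n), (∀ k, C k (σ k) ≠ 0) → σ = τ := by
      intro σ hσ
      have hsupp : ∀ k : Fin n,
          (k.val < i → (σ k).val = k.val ∨ (σ k).val = i) ∧
          (i ≤ k.val → k.val < n - 1 → (σ k).val = 0 ∨ (σ k).val = k.val + 1) ∧
          (k.val = n - 1 → (σ k).val = n - 1) := by
        intro k
        have h := hσ k
        rw [hC] at h
        refine ⟨fun h1 => ?_, fun h1 h2 => ?_, fun h1 => ?_⟩
        · by_contra! hc
          exact h (by simp [h1, hc.2, Fin.ext_iff, hc.1])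
        · by_contra! hc
          exact h (by simp [h2, not_lt.mpr h1, hc.1, hc.2])
        · by_contra hc
          exact h (by rw [if_neg (by omega), if_neg (by omega), if_neg hc])
      have hinj : ∀ a b : Fin n, (σ a).val = (σ b).val → a.val = b.val := fun a b hab =>
        congrArg Fin.val (σ.injective (Fin.ext hab))
      have hlast := (hsupp ⟨n - 1, by omega⟩).2.2 rfl
      have hpen : (σ ⟨n - 2, by omega⟩).val = 0 := by
        have h1 := (hsupp ⟨n - 2, by omega⟩).2.1 hi2 (by simp only; omega)
        have h2 := hinj ⟨n - 2, by omega⟩ ⟨n - 1, by omega⟩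
        simp only at h1 h2
        omega
      have hzero : (σ ⟨0, by omega⟩).val = i := by
        have h1 := (hsupp ⟨0, by omega⟩).1 hi1
        have h2 := hinj ⟨0, by omega⟩ ⟨n - 2, by omega⟩
        simp only at h1 h2
        omega
      ext k
      change (σ k).val = (f k).val
      rw [hfv]
      have h1 := hsupp k
      have h2 := hinj k ⟨0, by omega⟩
      have h3 := hinj k ⟨n - 2, by omega⟩
      simp only at h2 h3
      split_ifs with c1 c2 c3 c4
      · rw [← hzero]
        congr
        exact Fin.ext c1
      · omega
      · omega
      · rw [← hpen]
        congr
        exact Fin.ext c4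
      · omega
    rw [Matrix.abs_det_eq_abs_prod_of_unique_perm C τ hτ]
    let g : ℕ → ℝ := fun k =>
      if k = 0 then (j : ℝ) else if k < i then (n : ℝ) - j
      else if k < n - 2 then (j : ℝ) else if k = n - 2 then (n : ℝ) - j else n
    have hg : ∀ k : Fin n, C k (τ k) = g k.val := by
      intro k
      have hk := k.isLt
      change C k (f k) = _
      rw [hC]
      simp only [Fin.ext_iff, hfv, g]
      split_ifs <;> first | contradiction | omega | simp
    have hprod : ∏ k, C k (τ k) = (n : ℝ) * ((n : ℝ) - j) ^ i * (j : ℝ) ^ (n - i - 1) := by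
      rw [Finset.prod_congr rfl fun k _ => hg k, Fin.prod_univ_eq_prod_range g n]
      obtain ⟨a, rfl⟩ : ∃ a, i = a + 1 := ⟨i - 1, by omega⟩
      obtain ⟨b, hb⟩ : ∃ b, n = a + 1 + b + 1 + 1 := ⟨n - a - 3, by omega⟩
      have hA : ∏ k ∈ Finset.range (a + 1), g k = ((n : ℝ) - j) ^ a * j := by
        rw [Finset.prod_range_succ', Finset.prod_congr rfl (g := fun _ => (n : ℝ) - j)]
        · simp [g]
        · intro k hk
          have := Finset.mem_range.mp hk
          simp [g, this]
      have hB : ∏ k ∈ Finset.range b, g (a + 1 + k) = (j : ℝ) ^ b := by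
        rw [Finset.prod_congr rfl (g := fun _ => (j : ℝ))]
        · simp
        · intro k hk
          have := Finset.mem_range.mp hk
          simp only [g]
          split_ifs <;> first | contradiction | omega | rfl
      have hC' : g (a + 1 + b) = (n : ℝ) - j := by
        simp only [g]
        split_ifs <;> first | contradiction | omega | rfl
      have hD : g (a + 1 + b + 1) = n := by
        simp only [g]
        split_ifs <;> first | contradiction | omega | rfl
      have hr : Finset.range n = Finset.range (a + 1 + b + 1 + 1) := by rw [hb]
      rw [hr, Finset.prod_range_succ, Finset.prod_range_succ, Finset.prod_range_add, hA, hB, hC',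
        hD, show n - (a + 1) - 1 = b + 1 by omega]
      ring
    rw [hprod, abs_of_pos (by positivity)]
  have hli : LinearIndependent ℝ (fun k : Fin n => C k) := by
    refine Matrix.linearIndependent_rows_of_det_ne_zero (abs_pos.mp ?_)
    rw [hdet]
    positivity
  exact ⟨hdet, hli, hli.span_eq_top_of_card_eq_finrank' (by simp)⟩
end

section
/- Let C = { x ∈ ℝ^n : x_k ≥ 0 for every k ∈ [n], and ⟨x,ν⟩ ≥ 0 } and let R = { n·e_k : i+1 ≤ k ≤ n } ∪ { (n−j)e_r + j·e_s : 1 ≤ r ≤ i, i+1 ≤ s ≤ n }. Then C equals the set of all nonnegative real linear combinations of elements of R; moreover for every v ∈ R the ray { c·v : c ≥ 0 } is an extreme subset of C, and these are exactly the (i+1)(n−i) extremal rays of C. -/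
/-- The closed ray from the origin through `v`. -/
def ray {E : Type*} [AddCommGroup E] [Module ℝ E] (v : E) : Set E :=
  { x | ∃ c : ℝ, 0 ≤ c ∧ x = c • v }

section Ray

variable {E : Type*} [AddCommGroup E] [Module ℝ E]

theorem self_mem_ray (v : E) : v ∈ ray v :=
  ⟨1, zero_le_one, (one_smul ℝ v).symm⟩

theorem convex_ray (v : E) : Convex ℝ (ray v) := by
  rintro _ ⟨c, hc, rfl⟩ _ ⟨d, hd, rfl⟩ α β hα hβ -
  exact ⟨α * c + β * d, by positivity, by module⟩

theorem finrank_span_ray {v : E} (hv : v ≠ 0) :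
    Module.finrank ℝ (Submodule.span ℝ (ray v)) = 1 := by
  have h : Submodule.span ℝ (ray v) = Submodule.span ℝ {v} := by
    apply le_antisymm
    · rw [Submodule.span_le]
      rintro _ ⟨c, -, rfl⟩
      exact Submodule.smul_mem _ c (Submodule.mem_span_singleton_self v)
    · exact Submodule.span_mono (Set.singleton_subset_iff.2 (self_mem_ray v))
  rw [h, finrank_span_singleton hv]

theorem IsExtreme.smul_mem_of_convexCone {C : ConvexCone ℝ E} (hp : C.Pointed) {F : Set E}
    (hF : IsExtreme ℝ (C : Set E) F) {v : E} (hv : v ∈ F) {c : ℝ} (hc : 0 ≤ c) :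
    c • v ∈ F := by
  have hvC : v ∈ C := hF.subset hv
  rcases hc.eq_or_lt with rfl | hc
  · rw [zero_smul]
    exact hF.left_mem_of_mem_openSegment hp (C.smul_mem two_pos hvC) hv
      ⟨1 / 2, 1 / 2, by norm_num, by norm_num, by norm_num, by module⟩
  · refine hF.left_mem_of_mem_openSegment (C.smul_mem hc hvC)
      (C.smul_mem (inv_pos.2 hc) hvC) hv
      ⟨1 / (c + 1), c / (c + 1), by positivity, by positivity, by field_simp; ring, ?_⟩
    rw [smul_smul, smul_smul, ← add_smul]
    have h : 1 / (c + 1) * c + c / (c + 1) * c⁻¹ = 1 := by field_simp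
    rw [h, one_smul]

theorem IsExtreme.mem_of_add_mem_of_convexCone {C : ConvexCone ℝ E} (hp : C.Pointed) {F : Set E}
    (hF : IsExtreme ℝ (C : Set E) F) {x y : E} (hx : x ∈ C) (hy : y ∈ C) (hxy : x + y ∈ F) :
    x ∈ F := by
  have h : (2 : ℝ) • x ∈ F :=
    hF.left_mem_of_mem_openSegment (C.smul_mem two_pos hx) (C.smul_mem two_pos hy) hxy
      ⟨1 / 2, 1 / 2, by norm_num, by norm_num, by norm_num, by module⟩
  have h2 := hF.smul_mem_of_convexCone hp h (c := 1 / 2) (by norm_num)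
  rwa [smul_smul, one_div_mul_cancel two_ne_zero, one_smul] at h2

theorem IsExtreme.eq_ray_of_finrank_span_eq_one {C : ConvexCone ℝ E} (hp : C.Pointed)
    (hs : C.Salient) {F : Set E} (hF : IsExtreme ℝ (C : Set E) F)
    (h1 : Module.finrank ℝ (Submodule.span ℝ F) = 1) {v : E} (hv : v ∈ F) (hv0 : v ≠ 0) :
    F = ray v := by
  apply Set.Subset.antisymm
  · intro y hy
    obtain ⟨c, hc⟩ := (finrank_eq_one_iff_of_nonzero'
      (⟨v, Submodule.subset_span hv⟩ : Submodule.span ℝ F)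
      (fun h => hv0 (congrArg Subtype.val h))).1 h1 ⟨y, Submodule.subset_span hy⟩
    have hy' : c • v = y := congrArg Subtype.val hc
    refine ⟨c, ?_, hy'.symm⟩
    by_contra! hneg
    refine hs v (hF.subset hv) hv0 ?_
    have h := C.smul_mem (inv_pos.2 (neg_pos.2 hneg)) (hF.subset hy)
    have h2 : (-c)⁻¹ * c = -1 := by
      have := hneg.ne
      field_simp
    rwa [← hy', smul_smul, h2, neg_one_smul] at h
  · rintro _ ⟨c, hc, rfl⟩
    exact hF.smul_mem_of_convexCone hp hv hc

theorem ConvexCone.sum_smul_mem {C : ConvexCone ℝ E} (hp : C.Pointed) {κ : Type*} (s : Finset κ)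
    {c : κ → ℝ} {g : κ → E} (hc : ∀ q, 0 ≤ c q) (hg : ∀ q, g q ∈ C) :
    ∑ q ∈ s, c q • g q ∈ C := by
  refine Finset.sum_induction _ (· ∈ C) (fun _ _ hx hy => C.add_mem hx hy) hp fun q _ => ?_
  rcases (hc q).eq_or_lt with h | h
  · rw [← h, zero_smul]
    exact hp
  · exact C.smul_mem h (hg q)

/-- If a pointed salient cone is generated by finitely many nonzero vectors, each of which spans an
extreme ray, then these rays are all of its one-dimensional extreme subsets. -/
theorem ConvexCone.setOf_extremal_rays_eq {C : ConvexCone ℝ E} (hp : C.Pointed) (hs : C.Salient)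
    {κ : Type*} [Fintype κ] {g : κ → E} (hg0 : ∀ q, g q ≠ 0)
    (hext : ∀ q, IsExtreme ℝ (C : Set E) (ray (g q)))
    (hgen : ∀ x ∈ C, ∃ c : κ → ℝ, (∀ q, 0 ≤ c q) ∧ x = ∑ q, c q • g q) :
    { F : Set E | Convex ℝ F ∧ IsExtreme ℝ (C : Set E) F ∧
      Module.finrank ℝ (Submodule.span ℝ F) = 1 } = { F | ∃ v ∈ Set.range g, F = ray v } := by
  classical
  have hg : ∀ q, g q ∈ C := fun q => (hext q).subset (self_mem_ray _)
  ext F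
  constructor
  · rintro ⟨-, hF, h1⟩
    obtain ⟨x, hxF, hx0⟩ : ∃ x ∈ F, x ≠ 0 := by
      by_contra! h
      rw [Submodule.span_eq_bot.2 h, finrank_bot] at h1
      exact zero_ne_one h1
    obtain ⟨c, hc, hx⟩ := hgen x (hF.subset hxF)
    obtain ⟨q, hq⟩ : ∃ q, c q ≠ 0 := by
      by_contra! h
      exact hx0 (by simp [hx, h])
    have hpos : 0 < c q := (hc q).lt_of_ne' hq
    rw [hx, ← Finset.add_sum_erase _ _ (Finset.mem_univ q)] at hxF
    have h := hF.mem_of_add_mem_of_convexCone hp (C.smul_mem hpos (hg q))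
      (ConvexCone.sum_smul_mem hp _ hc hg) hxF
    have h2 := hF.smul_mem_of_convexCone hp h (inv_nonneg.2 hpos.le)
    rw [smul_smul, inv_mul_cancel₀ hq, one_smul] at h2
    exact ⟨g q, ⟨q, rfl⟩, hF.eq_ray_of_finrank_span_eq_one hp hs h1 h2 (hg0 q)⟩
  · rintro ⟨_, ⟨q, rfl⟩, rfl⟩
    exact ⟨convex_ray _, hext q, finrank_span_ray (hg0 q)⟩

end Ray

section ExtremalGenerator

variable {ι : Type*} [DecidableEq ι] (p : ι → Prop) (a b : ℝ)

/-- The generators of the extremal rays of `truncatedOrthant p a b`. -/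
def extremalGenerator :
    Option { k // p k } × { k // ¬ p k } → ι → ℝ
  | (none, s) => Pi.single s.1 (a + b)
  | (some r, s) => Pi.single r.1 a + Pi.single s.1 b

variable {p a b}

theorem extremalGenerator_pos_iff_of_not (ha : 0 < a) (hb : 0 < b)
    (q : Option { k // p k } × { k // ¬ p k }) {k : ι} (hk : ¬ p k) :
    0 < extremalGenerator p a b q k ↔ k = q.2 := by
  obtain ⟨_ | ⟨r, hr⟩, ⟨s, hs⟩⟩ := q
  · by_cases h : k = s <;> simp [extremalGenerator, h, add_pos ha hb]
  · have hkr : k ≠ r := fun h => hk (h ▸ hr)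
    by_cases h : k = s
    · subst h
      simp [extremalGenerator, hb, hkr]
    · simp [extremalGenerator, h, hkr]

theorem extremalGenerator_pos_iff_of_pred (ha : 0 < a)
    (q : Option { k // p k } × { k // ¬ p k }) (k : { k // p k }) :
    0 < extremalGenerator p a b q k ↔ q.1 = some k := by
  obtain ⟨k, hk⟩ := k
  obtain ⟨_ | ⟨r, hr⟩, ⟨s, hs⟩⟩ := q
  all_goals have hks : k ≠ s := fun h => hs (h ▸ hk)
  · simp [extremalGenerator, hks]
  · by_cases h : k = r
    · subst h
      simp [extremalGenerator, ha, hks]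
    · simp [extremalGenerator, h, hks, Ne.symm h]

theorem extremalGenerator_ne_zero (ha : 0 < a) (hb : 0 < b)
    (q : Option { k // p k } × { k // ¬ p k }) : extremalGenerator p a b q ≠ 0 := by
  intro h
  have := (extremalGenerator_pos_iff_of_not ha hb q q.2.2).2 rfl
  rw [h] at this
  exact lt_irrefl _ this

theorem ray_extremalGenerator_injective (ha : 0 < a) (hb : 0 < b) :
    Function.Injective fun q => ray (extremalGenerator p a b q) := by
  intro q q' (h : ray _ = ray _)
  obtain ⟨c, hc, hq⟩ : extremalGenerator p a b q ∈ ray (extremalGenerator p a b q') :=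
    h ▸ self_mem_ray _
  have hc' : 0 < c := hc.lt_of_ne' fun h0 =>
    extremalGenerator_ne_zero ha hb q (by rw [hq, h0, zero_smul])
  have key : ∀ k, 0 < extremalGenerator p a b q k ↔ 0 < extremalGenerator p a b q' k := by
    intro k
    rw [hq, Pi.smul_apply, smul_eq_mul, mul_pos_iff_of_pos_left hc']
  refine Prod.ext (Option.ext fun r => ?_) (Subtype.ext ?_)
  · exact (extremalGenerator_pos_iff_of_pred ha q r).symm.trans
      ((key r).trans (extremalGenerator_pos_iff_of_pred ha q' r))
  · exact (extremalGenerator_pos_iff_of_not ha hb q' q.2.2).1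
      ((key _).1 ((extremalGenerator_pos_iff_of_not ha hb q q.2.2).2 rfl))

end ExtremalGenerator

section TruncatedOrthant

variable {ι : Type*} [Fintype ι] (p : ι → Prop) [DecidablePred p] (a b : ℝ)

/-- The vector with entries `-b` where `p` holds and `a` elsewhere. -/
def twoValued (k : ι) : ℝ := if p k then -b else a

open Matrix in
/-- The part of the nonnegative orthant on which `twoValued p a b` is nonnegative. -/
def truncatedOrthant : ConvexCone ℝ (ι → ℝ) where
  carrier := { x | (∀ k, 0 ≤ x k) ∧ 0 ≤ x ⬝ᵥ twoValued p a b }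
  smul_mem' c hc x hx := by
    refine ⟨fun k => mul_nonneg hc.le (hx.1 k), ?_⟩
    rw [smul_dotProduct]
    exact mul_nonneg hc.le hx.2
  add_mem' x hx y hy := by
    refine ⟨fun k => add_nonneg (hx.1 k) (hy.1 k), ?_⟩
    rw [add_dotProduct]
    exact add_nonneg hx.2 hy.2

open Matrix

variable {p a b}

theorem pointed_truncatedOrthant : (truncatedOrthant p a b).Pointed :=
  ⟨fun _ => le_rfl, (zero_dotProduct _).ge⟩

theorem salient_truncatedOrthant : (truncatedOrthant p a b).Salient := by
  intro x hx hx0 hneg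
  refine hx0 (funext fun k => le_antisymm ?_ (hx.1 k))
  have := hneg.1 k
  rw [Pi.neg_apply] at this
  exact neg_nonneg.1 this

variable [DecidableEq ι]

theorem extremalGenerator_mem (ha : 0 < a) (hb : 0 < b)
    (q : Option { k // p k } × { k // ¬ p k }) :
    extremalGenerator p a b q ∈ truncatedOrthant p a b := by
  obtain ⟨_ | ⟨r, hr⟩, ⟨s, hs⟩⟩ := q
  · refine ⟨(Pi.single_nonneg.2 (add_pos ha hb).le : (0 : ι → ℝ) ≤ Pi.single s (a + b)), ?_⟩
    simp only [extremalGenerator, single_dotProduct, twoValued, hs, if_false]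
    positivity
  · refine ⟨(add_nonneg (Pi.single_nonneg.2 ha.le) (Pi.single_nonneg.2 hb.le) :
      (0 : ι → ℝ) ≤ Pi.single r a + Pi.single s b), ?_⟩
    simp only [extremalGenerator, add_dotProduct, single_dotProduct, twoValued, hs, hr, if_false,
      if_true]
    exact (by ring : a * -b + b * a = 0).ge

theorem isExtreme_ray_extremalGenerator (ha : 0 < a) (hb : 0 < b)
    (q : Option { k // p k } × { k // ¬ p k }) :
    IsExtreme ℝ (truncatedOrthant p a b : Set (ι → ℝ)) (ray (extremalGenerator p a b q)) := by
  refine ⟨?_, ?_⟩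
  · rintro _ ⟨c, hc, rfl⟩
    rcases hc.eq_or_lt with rfl | hc
    · rw [zero_smul]
      exact pointed_truncatedOrthant
    · exact ConvexCone.smul_mem _ hc (extremalGenerator_mem ha hb q)
  rintro x ⟨hx, hxν⟩ y ⟨hy, hyν⟩ _ ⟨t, ht, rfl⟩ ⟨α, β, hα, hβ, -, hxy⟩
  have left_eq_zero : ∀ {u v : ℝ}, 0 ≤ u → 0 ≤ v → α * u + β * v = 0 → u = 0 := by
    intro u v hu hv h
    have := (add_eq_zero_iff_of_nonneg (mul_nonneg hα.le hu) (mul_nonneg hβ.le hv)).1 h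
    exact (mul_eq_zero.1 this.1).resolve_left hα.ne'
  have hsupp : ∀ k, extremalGenerator p a b q k = 0 → x k = 0 := by
    intro k hk
    have := congrFun hxy k
    simp only [Pi.add_apply, Pi.smul_apply, smul_eq_mul, hk, mul_zero] at this
    exact left_eq_zero (hx k) (hy k) this
  obtain ⟨_ | ⟨r, hr⟩, ⟨s, hs⟩⟩ := q
  · refine ⟨x s / (a + b), div_nonneg (hx s) (add_pos ha hb).le, funext fun k => ?_⟩
    by_cases h : k = s
    · subst h
      have := (add_pos ha hb).ne'
      simp [extremalGenerator, this]
    · have h0 : extremalGenerator p a b (none, ⟨s, hs⟩) k = 0 := by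
        simp [extremalGenerator, h]
      rw [hsupp k h0, Pi.smul_apply, h0, smul_zero]
  · have hrs : r ≠ s := fun h => hs (h ▸ hr)
    have hx' : x = Pi.single r (x r) + Pi.single s (x s) := by
      funext k
      by_cases h1 : k = r
      · subst h1
        simp [hrs]
      · by_cases h2 : k = s
        · subst h2
          simp [h1]
        · have h0 : extremalGenerator p a b (some ⟨r, hr⟩, ⟨s, hs⟩) k = 0 := by
            simp [extremalGenerator, h1, h2]
          simp [hsupp k h0, h1, h2]
    have hx0 : x ⬝ᵥ twoValued p a b = 0 := by
      refine left_eq_zero hxν hyν ?_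
      rw [← smul_eq_mul, ← smul_eq_mul, ← smul_dotProduct, ← smul_dotProduct, ← add_dotProduct, hxy]
      simp only [extremalGenerator, add_dotProduct, smul_dotProduct, single_dotProduct, twoValued,
        hs, hr, if_false, if_true, smul_eq_mul]
      ring
    rw [hx'] at hx0
    simp only [add_dotProduct, single_dotProduct, twoValued, hs, hr, if_false, if_true] at hx0
    refine ⟨x r / a, div_nonneg (hx r) ha.le, ?_⟩
    have hxs : x s = x r / a * b := by
      field_simp
      linarith
    rw [extremalGenerator, smul_add, ← Pi.single_smul, ← Pi.single_smul, smul_eq_mul, smul_eq_mul,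
      div_mul_cancel₀ _ ha.ne', ← hxs]
    exact hx'

theorem exists_eq_sum_extremalGenerator (ha : 0 < a) (hb : 0 < b) {x : ι → ℝ}
    (hx : x ∈ truncatedOrthant p a b) :
    ∃ c : Option { k // p k } × { k // ¬ p k } → ℝ,
      (∀ q, 0 ≤ c q) ∧ x = ∑ q, c q • extremalGenerator p a b q := by
  obtain ⟨hx, hxν⟩ := hx
  set A : ℝ := ∑ r : { k // p k }, x r with hA
  set B : ℝ := ∑ s : { k // ¬ p k }, x s with hB
  have hdot : x ⬝ᵥ twoValued p a b = a * B - b * A := by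
    rw [dotProduct, ← Fintype.sum_subtype_add_sum_subtype p, hA, hB, Finset.mul_sum,
      Finset.mul_sum, sub_eq_neg_add, ← Finset.sum_neg_distrib]
    congr 1
    · refine Finset.sum_congr rfl fun r _ => ?_
      rw [twoValued, if_pos r.2]
      ring
    · refine Finset.sum_congr rfl fun s _ => ?_
      rw [twoValued, if_neg s.2]
      ring
  rw [hdot] at hxν
  have hA0 : 0 ≤ A := Finset.sum_nonneg fun r _ => hx r
  have hB0 : 0 ≤ B := Finset.sum_nonneg fun s _ => hx s
  rcases hB0.eq_or_lt with hB' | hBpos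
  · have hA' : A = 0 := by
      rw [← hB'] at hxν
      nlinarith
    refine ⟨0, fun _ => le_rfl, funext fun k => ?_⟩
    have hk : x k = 0 := by
      by_cases h : p k
      · exact (Finset.sum_eq_zero_iff_of_nonneg fun (r : { k // p k }) _ => hx r).1 hA' ⟨k, h⟩
          (Finset.mem_univ _)
      · exact (Finset.sum_eq_zero_iff_of_nonneg fun (s : { k // ¬ p k }) _ => hx s).1 hB'.symm ⟨k, h⟩
          (Finset.mem_univ _)
    simp [hk]
  · refine ⟨fun q => match q with
      | (none, s) => x s * ((a * B - b * A) / (a * B * (a + b)))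
      | (some r, s) => x r * (x s / (a * B)), ?_, funext fun k => ?_⟩
    · rintro ⟨_ | r, s⟩
      · exact mul_nonneg (hx _) (div_nonneg hxν (by positivity))
      · exact mul_nonneg (hx _) (div_nonneg (hx _) (by positivity))
    simp only [Fintype.sum_prod_type, Fintype.sum_option, extremalGenerator, Finset.sum_apply,
      Pi.add_apply, Pi.smul_apply, smul_eq_mul]
    by_cases h : p k
    · have hks : ∀ s : { k // ¬ p k }, k ≠ s := fun s hs => s.2 (hs ▸ h)
      simp only [Pi.single_apply, hks, if_false, mul_zero, Finset.sum_const_zero, zero_add,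
        add_zero]
      rw [Finset.sum_eq_single ⟨k, h⟩]
      · simp only [if_true]
        rw [← Finset.sum_mul, ← Finset.mul_sum, ← Finset.sum_div, ← hB]
        field_simp
      · intro r _ hr
        have : k ≠ r := fun e => hr (Subtype.ext e.symm)
        simp [this]
      · simp
    · have hkr : ∀ r : { k // p k }, k ≠ r := fun r hr => h (hr ▸ r.2)
      have hsum : ∀ f : { k // ¬ p k } → ℝ, ∀ d : ℝ,
          ∑ s, f s * (if k = s.1 then d else 0) = f ⟨k, h⟩ * d := by
        intro f d
        rw [Finset.sum_eq_single ⟨k, h⟩]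
        · simp
        · intro s _ hs
          have : k ≠ s := fun e => hs (Subtype.ext e.symm)
          simp [this]
        · simp
      simp only [Pi.single_apply, hkr, if_false, zero_add, hsum]
      rw [← Finset.sum_mul, ← Finset.sum_mul, ← hA]
      field_simp
      ring

end TruncatedOrthant

theorem nonnegSpan_range {n : ℕ} {κ : Type*} [Fintype κ] {g : κ → Fin n → ℝ}
    {C : ConvexCone ℝ (Fin n → ℝ)} (hp : C.Pointed) (hg : ∀ q, g q ∈ C)
    (hgen : ∀ x ∈ C, ∃ c : κ → ℝ, (∀ q, 0 ≤ c q) ∧ x = ∑ q, c q • g q) :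
    (C : Set (Fin n → ℝ)) = nonnegSpan (Set.range g) := by
  ext x
  constructor
  · intro hx
    obtain ⟨c, hc, hxc⟩ := hgen x hx
    let e := Fintype.equivFin κ
    refine ⟨Fintype.card κ, fun l => c (e.symm l), fun l => g (e.symm l), fun l => hc _,
      fun l => ⟨_, rfl⟩, ?_⟩
    rw [hxc]
    exact (Equiv.sum_comp e.symm fun q => c q • g q).symm
  · rintro ⟨m, c, v, hc, hv, rfl⟩
    refine ConvexCone.sum_smul_mem hp _ hc fun l => ?_
    obtain ⟨q, hq⟩ := hv l
    rw [← hq]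
    exact hg q

/-- the cone `C = {x : x_k ≥ 0 ∀k, ⟨x,ν⟩ ≥ 0}` is generated by
`R = {n·e_k : i+1 ≤ k ≤ n} ∪ {(n-j)e_r + j·e_s : 1 ≤ r ≤ i, i+1 ≤ s ≤ n}`
(0-based indexing below); each ray `{c·v : c ≥ 0}` with `v ∈ R` is an extreme
subset of `C`, these rays are exactly the extremal rays of `C` (the 1-dimensional
convex extreme subsets), and there are `(i+1)(n-i)` of them. -/
theorem cone_extremal_rays
    (n i j : ℕ) (hn : 3 ≤ n) (hi1 : 1 ≤ i) (hi2 : i ≤ n - 2)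
    (hj1 : 1 ≤ j) (hj2 : j ≤ n - 1)
    (ν : Fin n → ℝ) (hν : ∀ k : Fin n, ν k = if k.val < i then -(j : ℝ) else (n : ℝ) - j)
    (C : Set (Fin n → ℝ))
    (hC : C = { x | (∀ k, 0 ≤ x k) ∧ 0 ≤ ∑ k, x k * ν k })
    (R : Set (Fin n → ℝ))
    (hR : R = { v | (∃ k : Fin n, i ≤ k.val ∧ v = fun m => if m = k then (n : ℝ) else 0) ∨
        (∃ r s : Fin n, r.val < i ∧ i ≤ s.val ∧
          v = fun m => if m = r then (n : ℝ) - j else if m = s then (j : ℝ) else 0) }) :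
    C = nonnegSpan R ∧
    (∀ v ∈ R, IsExtreme ℝ C { x | ∃ c : ℝ, 0 ≤ c ∧ x = c • v }) ∧
    { F : Set (Fin n → ℝ) | Convex ℝ F ∧ IsExtreme ℝ C F ∧
        Module.finrank ℝ (Submodule.span ℝ F) = 1 } =
      { F | ∃ v ∈ R, F = { x | ∃ c : ℝ, 0 ≤ c ∧ x = c • v } } ∧
    Set.ncard { F : Set (Fin n → ℝ) | ∃ v ∈ R, F = { x | ∃ c : ℝ, 0 ≤ c ∧ x = c • v } } =
      (i + 1) * (n - i) := by
  have hb : (0 : ℝ) < j := by exact_mod_cast hj1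
  have ha : (0 : ℝ) < (n : ℝ) - j := by
    rw [sub_pos]
    exact_mod_cast (show j < n by omega)
  let p : Fin n → Prop := fun k => k.val < i
  have hCp : C = (truncatedOrthant p ((n : ℝ) - j) j : Set (Fin n → ℝ)) := by
    obtain rfl : ν = twoValued p ((n : ℝ) - j) j := funext hν
    exact hC
  have hRg : R = Set.range (extremalGenerator p ((n : ℝ) - j) j) := by
    have hnone : ∀ k : Fin n, (fun m => if m = k then (n : ℝ) else 0) =
        Pi.single k ((n : ℝ) - j + j) := by
      intro k
      funext m
      rw [Pi.single_apply, sub_add_cancel]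
    have hsome : ∀ r s : Fin n, r.val < i → i ≤ s.val →
        (fun m => if m = r then (n : ℝ) - j else if m = s then (j : ℝ) else 0) =
          Pi.single r ((n : ℝ) - j) + Pi.single s (j : ℝ) := by
      intro r s hr hs
      have hrs : r ≠ s := fun h => by
        subst h
        omega
      funext m
      rw [Pi.add_apply, Pi.single_apply, Pi.single_apply]
      by_cases h : m = r
      · subst h
        simp [hrs]
      · simp [h]
    rw [hR]
    ext v
    constructor
    · rintro (⟨k, hk, rfl⟩ | ⟨r, s, hr, hs, rfl⟩)
      · exact ⟨(none, ⟨k, not_lt.2 hk⟩), (hnone k).symm⟩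
      · exact ⟨(some ⟨r, hr⟩, ⟨s, not_lt.2 hs⟩), (hsome r s hr hs).symm⟩
    · rintro ⟨⟨_ | ⟨r, hr⟩, ⟨s, hs⟩⟩, rfl⟩
      · exact Or.inl ⟨s, not_lt.1 hs, (hnone s).symm⟩
      · exact Or.inr ⟨r, s, hr, not_lt.1 hs, (hsome r s hr (not_lt.1 hs)).symm⟩
  have hext := isExtreme_ray_extremalGenerator (p := p) ha hb
  have hgen : ∀ x ∈ truncatedOrthant p ((n : ℝ) - j) j, _ :=
    fun x => exists_eq_sum_extremalGenerator ha hb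
  rw [hCp, hRg]
  refine ⟨nonnegSpan_range pointed_truncatedOrthant (extremalGenerator_mem ha hb) hgen, ?_,
    ConvexCone.setOf_extremal_rays_eq pointed_truncatedOrthant salient_truncatedOrthant
      (extremalGenerator_ne_zero ha hb) hext hgen, ?_⟩
  · rintro _ ⟨q, rfl⟩
    exact hext q
  · have hrange : { F : Set (Fin n → ℝ) | ∃ v ∈ Set.range (extremalGenerator p ((n : ℝ) - j) j),
        F = { x | ∃ c : ℝ, 0 ≤ c ∧ x = c • v } } =
        Set.range fun q => ray (extremalGenerator p ((n : ℝ) - j) j q) := by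
      ext F
      exact Set.exists_range_iff.trans (exists_congr fun q => eq_comm)
    have hcard : Fintype.card { k : Fin n // p k } = i := by
      rw [Fintype.card_subtype]
      have := Fin.card_filter_val_lt (n := n) (m := i)
      rw [this]
      omega
    rw [hrange, ← Set.image_univ,
      Set.ncard_image_of_injective _ (ray_extremalGenerator_injective ha hb), Set.ncard_univ,
      Nat.card_eq_fintype_card, Fintype.card_prod, Fintype.card_option,
      Fintype.card_subtype_compl, hcard, Fintype.card_fin]
end

section
/- Let i+j ≤ n−1. The set M = { α ∈ ℕ^n : α_k ≥ 1 for every k ∈ [n], and there exists t with 1 ≤ t ≤ n−i−j−1 such that α_1+⋯+α_i = n+i−j+t and α_{i+1}+⋯+α_n = n−i+j−t } is finite of cardinality Σ_{t=1}^{n−i−j−1} C(n+i−j+t−1, i−1)·C(n−i+j−t−1, n−i−1), where C(·,·) denotes the binomial coefficient. (Consequently the Cohen–Macaulay type of the base ring K[𝒜] equals 1 plus this sum.) -/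
open Finset in
theorem Finset.card_piAntidiag_univ_nat (ι : Type*) [Fintype ι] [DecidableEq ι] (m : ℕ) :
    #(piAntidiag (univ : Finset ι) m) = (Fintype.card ι + m - 1).choose m := by
  rw [← map_sym_eq_piAntidiag, card_map, sym_univ, card_univ, Sym.card_sym_eq_choose]

/-- The functions `ι → ℕ` with positive values and sum `s`. -/
def positiveTuples (ι : Type*) [Fintype ι] [DecidableEq ι] (s : ℕ) : Finset (ι → ℕ) :=
  {f ∈ Finset.piAntidiag Finset.univ s | ∀ k, 1 ≤ f k}

theorem mem_positiveTuples {ι : Type*} [Fintype ι] [DecidableEq ι] {s : ℕ} {f : ι → ℕ} :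
    f ∈ positiveTuples ι s ↔ ∑ k, f k = s ∧ ∀ k, 1 ≤ f k := by
  simp [positiveTuples]

open Finset in
theorem card_positiveTuples (ι : Type*) [Fintype ι] [DecidableEq ι] [Nonempty ι] {s : ℕ}
    (hs : 1 ≤ s) :
    #(positiveTuples ι s) = (s - 1).choose (Fintype.card ι - 1) := by
  have hc : 0 < Fintype.card ι := Fintype.card_pos
  rcases lt_or_ge s (Fintype.card ι) with h | h
  · rw [Nat.choose_eq_zero_of_lt (by omega), card_eq_zero, eq_empty_iff_forall_notMem]
    intro f hf
    obtain ⟨hsum, hpos⟩ := mem_positiveTuples.1 hf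
    have : ∑ _k : ι, 1 ≤ ∑ k, f k := sum_le_sum fun k _ => hpos k
    simp only [sum_const, card_univ, smul_eq_mul, mul_one] at this
    omega
  · obtain ⟨m, rfl⟩ := Nat.exists_eq_add_of_le h
    have himage : positiveTuples ι (Fintype.card ι + m) =
        (piAntidiag univ m).map (addRightEmbedding (fun _ : ι => 1)) := by
      ext f
      simp only [mem_positiveTuples, mem_map, mem_piAntidiag, addRightEmbedding_apply]
      constructor
      · rintro ⟨hsum, hpos⟩
        have hf : (fun k => f k - 1) + (fun _ => 1) = f := by
          ext k
          simp [Nat.sub_add_cancel (hpos k)]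
        refine ⟨fun k => f k - 1, ⟨?_, by simp⟩, hf⟩
        rw [← hf] at hsum
        simp only [Pi.add_apply, sum_add_distrib, sum_const, card_univ, smul_eq_mul, mul_one]
          at hsum
        omega
      · rintro ⟨g, ⟨hg, -⟩, rfl⟩
        simp [sum_add_distrib, hg, add_comm]
    rw [himage, card_map, card_piAntidiag_univ_nat]
    exact Nat.choose_symm_of_eq_add (by omega)


/-- for `i + j ≤ n-1`, the set
`M = {α ∈ ℕ^n : α_k ≥ 1 ∀k, ∃ t ∈ [1, n-i-j-1], α_1+⋯+α_i = n+i-j+t and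
α_{i+1}+⋯+α_n = n-i+j-t}` is finite of cardinality
`Σ_{t=1}^{n-i-j-1} C(n+i-j+t-1, i-1) · C(n-i+j-t-1, n-i-1)`. -/
theorem card_M_of_add_le
    (n i j : ℕ) (hn : 3 ≤ n) (hi1 : 1 ≤ i) (hi2 : i ≤ n - 2)
    (hj1 : 1 ≤ j) (hj2 : j ≤ n - 1) (hij : i + j ≤ n - 1)
    (M : Set (Fin n → ℕ))
    (hM : M = { α | (∀ k, 1 ≤ α k) ∧ ∃ t : ℕ, 1 ≤ t ∧ t ≤ n - i - j - 1 ∧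
        (∑ k ∈ Finset.univ.filter (fun k : Fin n => k.val < i), (α k : ℤ))
          = (n : ℤ) + i - j + t ∧
        (∑ k ∈ Finset.univ.filter (fun k : Fin n => i ≤ k.val), (α k : ℤ))
          = (n : ℤ) - i + j - t }) :
    M.Finite ∧
    M.ncard = ∑ t ∈ Finset.Icc 1 (n - i - j - 1),
      Nat.choose (n + i - j + t - 1) (i - 1) * Nat.choose (n - i + j - t - 1) (n - i - 1) := by
  classical
  let e := Equiv.piEquivPiSubtypeProd (fun k : Fin n => k.val < i) (fun _ => ℕ)
  let P := fun t => positiveTuples {k : Fin n // k.val < i} (n + i - j + t) ×ˢ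
    positiveTuples {k : Fin n // ¬ k.val < i} (n - i + j - t)
  let S := ((Finset.Icc 1 (n - i - j - 1)).biUnion P).map e.symm.toEmbedding
  have hMS : M = S := by
    ext α
    simp only [hM, S, P, Set.mem_ofPred_eq, Finset.mem_coe, Finset.mem_map_equiv, Equiv.symm_symm,
      Finset.mem_biUnion, Finset.mem_product, mem_positiveTuples, Finset.mem_Icc, e,
      Equiv.piEquivPiSubtypeProd, Equiv.coe_fn_mk]
    have h1 : ∑ k : {k : Fin n // k.val < i}, α k =
        ∑ k ∈ Finset.univ.filter (fun k : Fin n => k.val < i), α k :=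
      (Finset.sum_subtype _ (by simp) α).symm
    have h2 : ∑ k : {k : Fin n // ¬ k.val < i}, α k =
        ∑ k ∈ Finset.univ.filter (fun k : Fin n => i ≤ k.val), α k :=
      (Finset.sum_subtype _ (by simp) α).symm
    simp only [h1, h2, ← Nat.cast_sum]
    constructor
    · rintro ⟨hpos, t, ht1, ht2, hs1, hs2⟩
      exact ⟨t, ⟨ht1, ht2⟩, ⟨by omega, fun k => hpos k⟩, by omega, fun k => hpos k⟩
    · rintro ⟨t, ⟨ht1, ht2⟩, ⟨hs1, hp1⟩, hs2, hp2⟩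
      refine ⟨fun k => ?_, t, ht1, ht2, by omega, by omega⟩
      by_cases hk : k.val < i
      · exact hp1 ⟨k, hk⟩
      · exact hp2 ⟨k, hk⟩
  have hcard1 : Fintype.card {k : Fin n // k.val < i} = i := by
    rw [Fintype.card_subtype, Fin.card_filter_val_lt]
    omega
  have hcard2 : Fintype.card {k : Fin n // ¬ k.val < i} = n - i := by
    rw [Fintype.card_subtype_compl, hcard1, Fintype.card_fin]
  have : Nonempty {k : Fin n // k.val < i} := Fintype.card_pos_iff.1 (by omega)
  have : Nonempty {k : Fin n // ¬ k.val < i} := Fintype.card_pos_iff.1 (by omega)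
  rw [hMS]
  refine ⟨S.finite_toSet, ?_⟩
  rw [Set.ncard_coe_finset, Finset.card_map, Finset.card_biUnion]
  · refine Finset.sum_congr rfl fun t ht => ?_
    rw [Finset.mem_Icc] at ht
    rw [Finset.card_product, card_positiveTuples _ (by omega), card_positiveTuples _ (by omega),
      hcard1, hcard2]
  · intro t _ u _ htu
    rw [Function.onFun, Finset.disjoint_left]
    intro p hp hq
    have hsum_t := (mem_positiveTuples.1 (Finset.mem_product.1 hp).1).1
    have hsum_u := (mem_positiveTuples.1 (Finset.mem_product.1 hq).1).1
    omega
end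

section
/- Let i+j ≥ n, let r = ⌈(i+1)/(n−j)⌉, and define M′ = { α ∈ ℕ^n : α_k ≥ 1 for every k ∈ [n], and there exists t with 1 ≤ t ≤ r(n−j)−i such that α_1+⋯+α_i = r(n−j)−t and α_{i+1}+⋯+α_n = rj+t }. Then { β ∈ ℕA : β_k ≥ 1 for every k ∈ [n], and ⟨β,ν⟩ > 0 } = ⋃_{α∈M′} ( α + ℕA ). (This set is the exponent set of the canonical module of the base ring K[𝒜], expressed by the Danilov–Stanley formula as the monomials with exponents in ℕA lying in the relative interior of ℝ₊A.) -/
open Finset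

/-- A function with given fibre sizes, taking values in `P` only on `Q`, exists exactly when
the total size is right and the size over `P` is at most that of `Q`. -/
theorem exists_fiber_card_iff {ι : Type*} [Fintype ι] [DecidableEq ι] (P : ι → Prop)
    [DecidablePred P] (Q : Finset ι) (x : ι → ℕ) :
    (∃ f : ι → ι, (∀ k, k ∉ Q → ¬ P (f k)) ∧ ∀ m, x m = #{k | f k = m}) ↔
      ∑ m, x m = Fintype.card ι ∧ ∑ m with P m, x m ≤ #Q := by
  have sum_fibers (f : ι → ι) (hf : ∀ m, x m = #{k | f k = m}) :
      ∑ m with P m, x m = #{k | P (f k)} := by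
    rw [card_eq_sum_card_fiberwise (f := f) (t := univ.filter P) (by intro k; simp)]
    refine sum_congr rfl fun m hm => ?_
    rw [hf, filter_filter]
    congr 1
    ext k
    simp only [mem_filter, mem_univ, true_and] at hm ⊢
    constructor
    · rintro rfl; exact ⟨hm, rfl⟩
    · exact fun h => h.2
  constructor
  · rintro ⟨f, hf, hx⟩
    constructor
    · simp only [hx]
      rw [← card_univ, card_eq_sum_card_fiberwise (f := f) (t := univ) (by intro k; simp)]
    · rw [sum_fibers f hx]
      refine card_le_card fun k hk => ?_
      by_contra hQ
      exact hf k hQ (by simpa using hk)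
  · rintro ⟨hsum, hP⟩
    have e : ι ≃ Σ m, Fin (x m) := Fintype.equivOfCardEq (by simp [hsum])
    let g : ι → ι := fun k => (e k).1
    have hg : ∀ m, x m = #{k | g k = m} := by
      intro m
      have : #{k | g k = m} = Fintype.card {y : Σ m, Fin (x m) // y.1 = m} := by
        rw [← Fintype.card_subtype]
        exact Fintype.card_congr (e.subtypeEquiv fun k => Iff.rfl)
      rw [this, Fintype.card_congr (Equiv.sigmaSubtype m), Fintype.card_fin]
    rw [sum_fibers g hg] at hP
    obtain ⟨Q', hQ', hcard⟩ := exists_subset_card_eq hP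
    have e' : {k // P (g k)} ≃ {k // k ∈ Q'} := Fintype.equivOfCardEq (by
      rw [Fintype.card_subtype, Fintype.card_coe, hcard])
    let σ : Equiv.Perm ι := e'.extendSubtype
    refine ⟨fun k => g (σ.symm k), fun k hk hPk => hk (hQ' ?_), fun m => ?_⟩
    · simpa [σ] using e'.extendSubtype_mem (σ.symm k) hPk
    · rw [hg, ← Fintype.card_subtype, ← Fintype.card_subtype]
      exact Fintype.card_congr (σ.subtypeEquiv fun k => by simp)

theorem exists_le_sum_eq {ι : Type*} [DecidableEq ι] (S : Finset ι) (β : ι → ℕ) :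
    ∀ m ≤ ∑ k ∈ S, β k, ∃ α ≤ β, ∑ k ∈ S, α k = m := by
  intro m
  induction m with
  | zero => exact fun _ => ⟨0, fun k => Nat.zero_le _, by simp⟩
  | succ m ih =>
    intro hm
    obtain ⟨α, hα, hs⟩ := ih (by omega)
    obtain ⟨a, ha, hlt⟩ := exists_lt_of_sum_lt (show ∑ k ∈ S, α k < ∑ k ∈ S, β k by omega)
    refine ⟨α + Pi.single a 1, fun k => ?_, ?_⟩
    · obtain rfl | hk := eq_or_ne k a
      · simpa using hlt
      · simpa [hk] using hα k
    · simp [sum_add_distrib, hs, ha]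

/-- Interpolation between two vectors with prescribed sums over `P` and over its complement. -/
theorem exists_between_sum_eq {ι : Type*} [Fintype ι] [DecidableEq ι] (P : ι → Prop)
    [DecidablePred P] {l β : ι → ℕ} (hl : l ≤ β) {a b : ℕ}
    (ha₁ : ∑ k with P k, l k ≤ a) (ha₂ : a ≤ ∑ k with P k, β k)
    (hb₁ : ∑ k with ¬ P k, l k ≤ b) (hb₂ : b ≤ ∑ k with ¬ P k, β k) :
    ∃ α, l ≤ α ∧ α ≤ β ∧ ∑ k with P k, α k = a ∧ ∑ k with ¬ P k, α k = b := by
  have hsplit : ∀ S : Finset ι, ∑ k ∈ S, (β - l) k + ∑ k ∈ S, l k = ∑ k ∈ S, β k := by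
    intro S
    rw [← sum_add_distrib]
    exact sum_congr rfl fun k _ => Nat.sub_add_cancel (hl k)
  obtain ⟨u, hu, hus⟩ := exists_le_sum_eq {k | P k} (β - l) (a - ∑ k with P k, l k)
    (by have := hsplit {k | P k}; omega)
  obtain ⟨v, hv, hvs⟩ := exists_le_sum_eq {k | ¬ P k} (β - l)
    (b - ∑ k with ¬ P k, l k) (by have := hsplit {k | ¬ P k}; omega)
  refine ⟨fun k => l k + if P k then u k else v k, fun k => by simp, fun k => ?_, ?_, ?_⟩
  · have h₁ : u k ≤ β k - l k := hu k
    have h₂ : v k ≤ β k - l k := hv k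
    have h₃ : l k ≤ β k := hl k
    dsimp only
    split_ifs <;> omega
  · rw [sum_add_distrib, sum_congr rfl fun k hk => if_pos (mem_filter.1 hk).2, hus]
    omega
  · rw [sum_add_distrib, sum_congr rfl fun k hk => if_neg (mem_filter.1 hk).2, hvs]
    omega

/-- The submonoid generated by the vectors of degree `n` whose sum over `P` is at most `p`. -/
theorem mem_closure_degree_iff {ι : Type*} [Fintype ι] [DecidableEq ι] (P : ι → Prop)
    [DecidablePred P] {n p : ℕ} (hpn : p ≤ n) (β : ι → ℕ) :
    β ∈ AddSubmonoid.closure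
        {x : ι → ℕ | ∑ k with P k, x k + ∑ k with ¬ P k, x k = n ∧ ∑ k with P k, x k ≤ p} ↔
      ∃ s, ∑ k with P k, β k + ∑ k with ¬ P k, β k = s * n ∧ ∑ k with P k, β k ≤ s * p := by
  constructor
  · intro h
    induction h using AddSubmonoid.closure_induction with
    | mem x hx => exact ⟨1, by simpa using hx⟩
    | zero => exact ⟨0, by simp⟩
    | add x y _ _ hx hy =>
      obtain ⟨s, hs, hs'⟩ := hx
      obtain ⟨t, ht, ht'⟩ := hy
      refine ⟨s + t, ?_, ?_⟩ <;> simp only [Pi.add_apply, sum_add_distrib, add_mul] <;> omega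
  · rintro ⟨s, hs⟩
    induction s generalizing β with
    | zero =>
      have : β = 0 := by
        have h := hs.1
        rw [sum_filter_add_sum_filter_not] at h
        ext k
        simpa using (sum_eq_zero_iff.1 (h.trans (zero_mul n))) k (mem_univ k)
      exact this ▸ zero_mem _
    | succ s ih =>
      obtain ⟨h₁, h₂⟩ := hs
      rw [add_mul, one_mul] at h₁ h₂
      have hsp : s * p ≤ s * n := Nat.mul_le_mul_left s hpn
      set L := ∑ k with P k, β k
      set H := ∑ k with ¬ P k, β k
      obtain ⟨α, -, hα, hL, hH⟩ := exists_between_sum_eq P (l := 0) (β := β) (a := min L p)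
        (b := n - min L p) (fun k => Nat.zero_le _) (by simp) (min_le_left _ _) (by simp)
        (by change _ ≤ H; omega)
      have hβ : β = α + (β - α) := (add_tsub_cancel_of_le hα).symm
      have hL' : L = min L p + ∑ k with P k, (β - α) k := by
        rw [← hL, ← sum_add_distrib]
        exact sum_congr rfl fun k _ => congrFun hβ k
      have hH' : H = n - min L p + ∑ k with ¬ P k, (β - α) k := by
        rw [← hH, ← sum_add_distrib]
        exact sum_congr rfl fun k _ => congrFun hβ k
      rw [hβ]
      refine add_mem (AddSubmonoid.subset_closure ⟨?_, ?_⟩) (ih _ ⟨?_, ?_⟩) <;> omega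

/-- An element of degree `s` with positive entries and sum over `P` below `s * p` splits off an
element of the same kind in the smallest degree `r` where such elements exist. -/
theorem exists_interior_add {ι : Type*} [Fintype ι] [DecidableEq ι] (P : ι → Prop)
    [DecidablePred P] {n p r s : ℕ} (hpn : p ≤ n)
    (hr : #{k | P k} < r * p) (hnP : r * p + #{k | ¬ P k} ≤ r * n + 1) (hrs : r ≤ s)
    {β : ι → ℕ} (hβ : 1 ≤ β)
    (hdeg : ∑ k with P k, β k + ∑ k with ¬ P k, β k = s * n) (hlt : ∑ k with P k, β k < s * p) :
    ∃ α γ : ι → ℕ, β = α + γ ∧ 1 ≤ α ∧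
      ∑ k with P k, α k + ∑ k with ¬ P k, α k = r * n ∧ ∑ k with P k, α k < r * p ∧
      ∑ k with P k, γ k + ∑ k with ¬ P k, γ k = (s - r) * n ∧
      ∑ k with P k, γ k ≤ (s - r) * p := by
  obtain ⟨d, rfl⟩ := Nat.exists_eq_add_of_le hrs
  rw [Nat.add_sub_cancel_left]
  have hcard : ∀ S : Finset ι, #S ≤ ∑ k ∈ S, β k := fun S => by
    simpa using sum_le_sum (s := S) fun k _ => hβ k
  have hP := hcard {k | P k}
  have hdp : d * p ≤ d * n := Nat.mul_le_mul_left d hpn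
  rw [add_mul] at hdeg hlt
  set L := ∑ k with P k, β k
  set H := ∑ k with ¬ P k, β k
  obtain ⟨α, hα₁, hα, hL, hH⟩ := exists_between_sum_eq P (l := 1) (β := β)
    (a := max #{k | P k} (L - d * p)) (b := r * n - max #{k | P k} (L - d * p)) hβ
    (by simp) (by change _ ≤ L; omega) (by simp only [Pi.one_apply, sum_const, smul_eq_mul]; omega)
    (by change _ ≤ H; omega)
  have hγ : β = α + (β - α) := (add_tsub_cancel_of_le hα).symm
  have hL' : L = ∑ k with P k, α k + ∑ k with P k, (β - α) k := by
    rw [← sum_add_distrib]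
    exact sum_congr rfl fun k _ => congrFun hγ k
  have hH' : H = ∑ k with ¬ P k, α k + ∑ k with ¬ P k, (β - α) k := by
    rw [← sum_add_distrib]
    exact sum_congr rfl fun k _ => congrFun hγ k
  refine ⟨α, β - α, hγ, hα₁, ?_, ?_, ?_, ?_⟩ <;> omega

theorem card_fin_filter_lt {n i : ℕ} (hi : i < n) : #{k : Fin n | k.val < i} = i := by
  have : ({k : Fin n | k.val < i} : Finset (Fin n)) = Iio ⟨i, hi⟩ := by
    ext k; simp [Fin.lt_def]
  rw [this, Fin.card_Iio]


/-- for `i + j ≥ n` and `r = ⌈(i+1)/(n-j)⌉`, with `A` the exponent set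
(in `ℕ^n`) of the generators of the base ring `K[𝒜]` and
`M' = {α ∈ ℕ^n : α_k ≥ 1 ∀k, ∃ t ∈ [1, r(n-j)-i], α_1+⋯+α_i = r(n-j)-t and
α_{i+1}+⋯+α_n = rj+t}`, the exponent set of the canonical module,
`{β ∈ ℕA : β_k ≥ 1 ∀k, ⟨β,ν⟩ > 0}`, equals `⋃_{α ∈ M'} (α + ℕA)`. -/
theorem canonical_module_exponents_of_le_add
    (n i j r : ℕ) (hn : 3 ≤ n) (hi1 : 1 ≤ i) (hi2 : i ≤ n - 2)
    (hj1 : 1 ≤ j) (hj2 : j ≤ n - 1) (hij : n ≤ i + j)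
    (hr : (r : ℤ) = Int.ceil (((i : ℚ) + 1) / ((n : ℚ) - (j : ℚ))))
    (A : Set (Fin n → ℕ))
    (hA : A = { x | ∃ f : Fin n → Fin n,
        (∀ k : Fin n, (k.val + n < i + j ∨ i ≤ k.val) → i ≤ (f k).val) ∧
        ∀ m : Fin n, x m = (Finset.univ.filter (fun k => f k = m)).card })
    (M' : Set (Fin n → ℕ))
    (hM' : M' = { α | (∀ k, 1 ≤ α k) ∧ ∃ t : ℕ, 1 ≤ t ∧ t ≤ r * (n - j) - i ∧
        (∑ k ∈ Finset.univ.filter (fun k : Fin n => k.val < i), (α k : ℤ))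
          = (r : ℤ) * ((n : ℤ) - j) - t ∧
        (∑ k ∈ Finset.univ.filter (fun k : Fin n => i ≤ k.val), (α k : ℤ))
          = (r : ℤ) * j + t }) :
    { β : Fin n → ℕ | β ∈ AddSubmonoid.closure A ∧ (∀ k, 1 ≤ β k) ∧
        0 < -(j : ℤ) * (∑ k ∈ Finset.univ.filter (fun k : Fin n => k.val < i), (β k : ℤ))
            + ((n : ℤ) - j) * (∑ k ∈ Finset.univ.filter (fun k : Fin n => i ≤ k.val), (β k : ℤ)) }
    = ⋃ α ∈ M', { β | ∃ γ ∈ AddSubmonoid.closure A, β = α + γ } := by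
  obtain ⟨p, hp⟩ : ∃ p, p = n - j := ⟨_, rfl⟩
  have hpz : (n : ℤ) - j = p := by omega
  have hp0 : 0 < p := by omega
  have hpn : p ≤ n := by omega
  have hi : i < n := by omega
  have hle_iff (s : ℕ) : r ≤ s ↔ i + 1 ≤ s * p := by
    have hpq : (n : ℚ) - j = p := by exact_mod_cast hpz
    rw [← Int.ofNat_le, hr, Int.ceil_le, hpq, div_le_iff₀ (by exact_mod_cast hp0)]
    exact_mod_cast Iff.rfl
  have hrp : i + 1 ≤ r * p := (hle_iff r).1 le_rfl
  have hr0 : 1 ≤ r := by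
    by_contra h
    obtain rfl : r = 0 := by omega
    omega
  have hrn : r * n = r * p + r * j := by rw [← mul_add]; congr 1; omega
  have hrj : j ≤ r * j := Nat.le_mul_of_pos_left j hr0
  let P : Fin n → Prop := fun k => k.val < i
  have hcardP : #{k | P k} = i := card_fin_filter_lt hi
  have hcardnP : #{k | ¬ P k} = n - i := by
    have := card_filter_add_card_filter_not (s := (univ : Finset (Fin n))) P
    rw [hcardP, card_univ, Fintype.card_fin] at this
    omega
  have hA' : A = {x | ∑ k with P k, x k + ∑ k with ¬ P k, x k = n ∧ ∑ k with P k, x k ≤ p} := by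
    have hQ : #(Ico (⟨i + j - n, by omega⟩ : Fin n) ⟨i, hi⟩) = p := by
      rw [Fin.card_Ico]; dsimp only; omega
    rw [hA]
    ext x
    have := exists_fiber_card_iff P (Ico (⟨i + j - n, by omega⟩ : Fin n) ⟨i, hi⟩) x
    rw [hQ, Fintype.card_fin] at this
    rw [Set.mem_ofPred_eq, Set.mem_ofPred_eq, sum_filter_add_sum_filter_not, ← this]
    refine exists_congr fun f => and_congr_left fun _ => forall_congr' fun k => ?_
    simp only [P, mem_Ico, Fin.le_def, Fin.lt_def, not_lt]
    exact imp_congr_left (by omega)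
  have hfilter : univ.filter (fun k : Fin n => i ≤ k.val) = univ.filter (fun k => ¬ P k) := by simp [P]
  have hmem (β : Fin n → ℕ) := mem_closure_degree_iff P hpn β
  rw [← hA'] at hmem
  have hM (α : Fin n → ℕ) : α ∈ M' ↔ 1 ≤ α ∧
      ∑ k with P k, α k + ∑ k with ¬ P k, α k = r * n ∧ ∑ k with P k, α k < r * p := by
    rw [hM', Set.mem_ofPred_eq, hfilter, hpz, ← hp, ← Nat.cast_sum, ← Nat.cast_sum]
    refine and_congr_right fun hα => ?_
    have hcard : i ≤ ∑ k with P k, α k := by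
      simpa [hcardP] using sum_le_sum (s := univ.filter P) fun k _ => hα k
    change (∃ t : ℕ, _ ∧ _ ∧ ((∑ k with P k, α k : ℕ) : ℤ) = _ ∧ _) ↔ _
    rw [← Nat.cast_mul, ← Nat.cast_mul]
    constructor
    · rintro ⟨t, h₁, h₂, h₃, h₄⟩
      constructor <;> omega
    · rintro ⟨h₁, h₂⟩
      exact ⟨r * p - ∑ k with P k, α k, by omega, by omega, by omega, by omega⟩
  have hpos {β : Fin n → ℕ} {s : ℕ} (hs : ∑ k with P k, β k + ∑ k with ¬ P k, β k = s * n) :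
      0 < -(j : ℤ) * (∑ k with P k, (β k : ℤ)) + ((n : ℤ) - j) * (∑ k with ¬ P k, (β k : ℤ)) ↔
        ∑ k with P k, β k < s * p := by
    rw [← Nat.cast_sum, ← Nat.cast_sum]
    have h : -(j : ℤ) * (∑ k with P k, β k : ℕ) + ((n : ℤ) - j) * (∑ k with ¬ P k, β k : ℕ)
        = n * ((s * p : ℕ) - (∑ k with P k, β k : ℕ)) := by
      have hs' : ((∑ k with P k, β k : ℕ) : ℤ) + (∑ k with ¬ P k, β k : ℕ) = s * n := by
        exact_mod_cast hs
      rw [Nat.cast_mul, ← hpz]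
      linear_combination ((n : ℤ) - j) * hs'
    rw [h, mul_pos_iff_of_pos_left (by omega), sub_pos, Nat.cast_lt]
  ext β
  simp only [Set.mem_ofPred_eq, Set.mem_iUnion, exists_prop, hfilter]
  constructor
  · rintro ⟨hβ, hβ₁, hβν⟩
    obtain ⟨s, hs, -⟩ := (hmem β).1 hβ
    have hlt := (hpos hs).1 hβν
    have hcard : i ≤ ∑ k with P k, β k := by
      simpa [hcardP] using sum_le_sum (s := univ.filter P) fun k _ => hβ₁ k
    obtain ⟨α, γ, rfl, hα₁, hα, hα', hγ⟩ := exists_interior_add P hpn (by omega) (by omega)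
      ((hle_iff s).2 (by omega)) hβ₁ hs hlt
    exact ⟨α, (hM α).2 ⟨hα₁, hα, hα'⟩, γ, (hmem γ).2 ⟨_, hγ⟩, rfl⟩
  · rintro ⟨α, hα, γ, hγ, rfl⟩
    obtain ⟨hα₁, hα, hα'⟩ := (hM α).1 hα
    have hαA : α ∈ AddSubmonoid.closure A := (hmem α).2 ⟨r, hα, hα'.le⟩
    obtain ⟨s, hs, hs'⟩ := (hmem γ).1 hγ
    refine ⟨add_mem hαA hγ, fun k => le_add_right (hα₁ k), (hpos (s := r + s) ?_).2 ?_⟩ <;>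
      simp only [Pi.add_apply, sum_add_distrib, add_mul] <;> omega
end

section
/- Let i+j ≥ n and r = ⌈(i+1)/(n−j)⌉. The set M′ = { α ∈ ℕ^n : α_k ≥ 1 for every k ∈ [n], and there exists t with 1 ≤ t ≤ r(n−j)−i such that α_1+⋯+α_i = r(n−j)−t and α_{i+1}+⋯+α_n = rj+t } is finite of cardinality Σ_{t=1}^{r(n−j)−i} C(r(n−j)−t−1, i−1)·C(rj+t−1, n−i−1), where C(·,·) denotes the binomial coefficient. (Consequently the Cohen–Macaulay type of the base ring K[𝒜] equals this sum.) -/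
open Finset in
/-- The compositions of `s` into positive parts indexed by `ι`. -/
def posCompositions (ι : Type*) [Fintype ι] [DecidableEq ι] (s : ℕ) : Finset (ι → ℕ) :=
  (univ.piAntidiag s).filter fun f => ∀ k, 1 ≤ f k

lemma mem_posCompositions {ι : Type*} [Fintype ι] [DecidableEq ι] {s : ℕ} {f : ι → ℕ} :
    f ∈ posCompositions ι s ↔ (∀ k, 1 ≤ f k) ∧ ∑ k, f k = s := by
  simp [posCompositions, and_comm]

lemma card_posCompositions {ι : Type*} [Fintype ι] [DecidableEq ι] [Nonempty ι] {s : ℕ}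
    (hs : 1 ≤ s) :
    (posCompositions ι s).card = (s - 1).choose (Fintype.card ι - 1) := by
  have hι : 0 < Fintype.card ι := Fintype.card_pos
  rcases le_or_gt (Fintype.card ι) s with h | h
  · have hcard : (posCompositions ι s).card
        = ((Finset.univ : Finset ι).finsuppAntidiag (s - Fintype.card ι)).card := by
      symm
      refine Finset.card_bij' (fun f _ k => f k + 1)
        (fun g _ => Finsupp.equivFunOnFinite.symm fun k => g k - 1) ?_ ?_ ?_ ?_
      · intro f hf
        have hf' : ∑ k, f k = s - Fintype.card ι := by simpa using hf
        refine mem_posCompositions.2 ⟨fun k => by omega, ?_⟩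
        rw [Finset.sum_add_distrib, hf']
        simp [h]
      · intro g hg
        obtain ⟨hpos, hsum⟩ := mem_posCompositions.1 hg
        have hg' : ∑ k, (g k - 1) + Fintype.card ι = s := by
          rw [← hsum, Fintype.card_eq_sum_ones, ← Finset.sum_add_distrib]
          exact Finset.sum_congr rfl fun k _ => Nat.sub_add_cancel (hpos k)
        simp only [Finset.mem_finsuppAntidiag, Finsupp.equivFunOnFinite_symm_apply_apply,
          Finset.subset_univ, and_true]
        omega
      · intro f _
        ext k
        simp
      · intro g hg
        funext k
        simpa using Nat.sub_add_cancel ((mem_posCompositions.1 hg).1 k)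
    rw [hcard, Finset.card_finsuppAntidiag_nat_eq_choose, Finset.card_univ,
      Nat.add_sub_cancel' h]
    exact Nat.choose_symm_of_eq_add (by omega)
  · rw [Nat.choose_eq_zero_of_lt (by omega), Finset.card_eq_zero, Finset.eq_empty_iff_forall_notMem]
    intro f hf
    obtain ⟨hpos, hsum⟩ := mem_posCompositions.1 hf
    have : Fintype.card ι ≤ ∑ k, f k := by
      rw [Fintype.card_eq_sum_ones]
      exact Finset.sum_le_sum fun k _ => hpos k
    omega

/-- The tuples of positive integers whose entries over `p` sum to `a` and whose remaining entries
sum to `b`. -/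
def splitCompositions {ι : Type*} [Fintype ι] [DecidableEq ι] (p : ι → Prop) [DecidablePred p]
    (a b : ℕ) : Finset (ι → ℕ) :=
  (posCompositions {k // p k} a ×ˢ posCompositions {k // ¬ p k} b).map
    (Equiv.piEquivPiSubtypeProd p fun _ => ℕ).symm.toEmbedding

lemma mem_splitCompositions {ι : Type*} [Fintype ι] [DecidableEq ι] {p : ι → Prop}
    [DecidablePred p] {a b : ℕ} {f : ι → ℕ} :
    f ∈ splitCompositions p a b ↔ (∀ k, 1 ≤ f k) ∧
      ∑ k ∈ Finset.univ.filter p, f k = a ∧ ∑ k ∈ Finset.univ.filter (¬ p ·), f k = b := by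
  rw [splitCompositions, Finset.mem_map_equiv, Equiv.symm_symm, Finset.mem_product,
    mem_posCompositions, mem_posCompositions,
    Finset.sum_subtype (Finset.univ.filter p) (p := p) (by simp),
    Finset.sum_subtype (Finset.univ.filter (¬ p ·)) (p := (¬ p ·)) (by simp)]
  simp only [Equiv.piEquivPiSubtypeProd_apply, Subtype.forall]
  constructor
  · rintro ⟨⟨h₁, h₂⟩, h₃, h₄⟩
    exact ⟨fun k => (em (p k)).elim (h₁ k) (h₃ k), h₂, h₄⟩
  · rintro ⟨h, h₁, h₂⟩
    exact ⟨⟨fun k _ => h k, h₁⟩, fun k _ => h k, h₂⟩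

lemma card_splitCompositions {ι : Type*} [Fintype ι] [DecidableEq ι] {p : ι → Prop}
    [DecidablePred p] [Nonempty {k // p k}] [Nonempty {k // ¬ p k}] {a b : ℕ}
    (ha : 1 ≤ a) (hb : 1 ≤ b) :
    (splitCompositions p a b).card = (a - 1).choose (Fintype.card {k // p k} - 1) *
      (b - 1).choose (Fintype.card {k // ¬ p k} - 1) := by
  rw [splitCompositions, Finset.card_map, Finset.card_product, card_posCompositions ha,
    card_posCompositions hb]


/-- for `i + j ≥ n` and `r = ⌈(i+1)/(n-j)⌉`, the set
`M' = {α ∈ ℕ^n : α_k ≥ 1 ∀k, ∃ t ∈ [1, r(n-j)-i], α_1+⋯+α_i = r(n-j)-t and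
α_{i+1}+⋯+α_n = rj+t}` is finite of cardinality
`Σ_{t=1}^{r(n-j)-i} C(r(n-j)-t-1, i-1) · C(rj+t-1, n-i-1)`. -/
theorem card_M'_of_le_add
    (n i j r : ℕ) (hn : 3 ≤ n) (hi1 : 1 ≤ i) (hi2 : i ≤ n - 2)
    (hj1 : 1 ≤ j) (hj2 : j ≤ n - 1) (hij : n ≤ i + j)
    (hr : (r : ℤ) = Int.ceil (((i : ℚ) + 1) / ((n : ℚ) - (j : ℚ))))
    (M' : Set (Fin n → ℕ))
    (hM' : M' = { α | (∀ k, 1 ≤ α k) ∧ ∃ t : ℕ, 1 ≤ t ∧ t ≤ r * (n - j) - i ∧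
        (∑ k ∈ Finset.univ.filter (fun k : Fin n => k.val < i), (α k : ℤ))
          = (r : ℤ) * ((n : ℤ) - j) - t ∧
        (∑ k ∈ Finset.univ.filter (fun k : Fin n => i ≤ k.val), (α k : ℤ))
          = (r : ℤ) * j + t }) :
    M'.Finite ∧
    M'.ncard = ∑ t ∈ Finset.Icc 1 (r * (n - j) - i),
      Nat.choose (r * (n - j) - t - 1) (i - 1) * Nat.choose (r * j + t - 1) (n - i - 1) := by
  have hM : M' = ↑((Finset.Icc 1 (r * (n - j) - i)).biUnion fun t =>
      splitCompositions (fun k : Fin n => k.val < i) (r * (n - j) - t) (r * j + t)) := by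
    subst hM'
    ext α
    simp only [Set.mem_ofPred_eq, Finset.mem_coe, Finset.mem_biUnion, Finset.mem_Icc,
      mem_splitCompositions, not_lt]
    have key : ∀ t : ℕ, t ≤ r * (n - j) - i →
        ((r : ℤ) * ((n : ℤ) - j) - t = ((r * (n - j) - t : ℕ) : ℤ)) := by
      intro t ht
      rw [Nat.cast_sub (by omega), Nat.cast_mul, Nat.cast_sub (by omega)]
    constructor
    · rintro ⟨hpos, t, h₁, h₂, h₃, h₄⟩
      rw [key t h₂] at h₃
      exact ⟨t, ⟨h₁, h₂⟩, hpos, by exact_mod_cast h₃, by exact_mod_cast h₄⟩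
    · rintro ⟨t, ⟨h₁, h₂⟩, hpos, h₃, h₄⟩
      refine ⟨hpos, t, h₁, h₂, ?_, by exact_mod_cast h₄⟩
      rw [key t h₂]
      exact_mod_cast h₃
  have hlt : Fintype.card {k : Fin n // k.val < i} = i := by
    rw [Fintype.card_subtype, Fin.card_filter_val_lt]
    omega
  have hge : Fintype.card {k : Fin n // ¬ k.val < i} = n - i := by
    rw [Fintype.card_subtype_compl, hlt, Fintype.card_fin]
  have : Nonempty {k : Fin n // k.val < i} := Fintype.card_pos_iff.1 (by omega)
  have : Nonempty {k : Fin n // ¬ k.val < i} := Fintype.card_pos_iff.1 (by omega)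
  refine hM ▸ ⟨Finset.finite_toSet _, ?_⟩
  rw [Set.ncard_coe_finset, Finset.card_biUnion]
  · refine Finset.sum_congr rfl fun t ht => ?_
    rw [Finset.mem_Icc] at ht
    rw [card_splitCompositions (by omega) (by omega), hlt, hge]
  · intro t _ u _ htu
    refine Finset.disjoint_left.2 fun α ht hu => htu ?_
    have h₁ := (mem_splitCompositions.1 ht).2.2
    have h₂ := (mem_splitCompositions.1 hu).2.2
    omega
end

section
/- Let i+j ≤ n−1. Then the minimum of β_1+⋯+β_n over all β ∈ ℕA with β_k ≥ 1 for every k ∈ [n] and ⟨β,ν⟩ > 0 equals n. (Equivalently, the least degree of a nonzero graded component of the canonical module of K[𝒜] is 1, so the a-invariant of K[𝒜] equals −1.) -/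
/-- a-invariant, case `i + j ≤ n-1`: the minimum of `β_1+⋯+β_n` over
all `β ∈ ℕA` with `β_k ≥ 1` for all `k` and `⟨β,ν⟩ > 0` equals `n`; equivalently,
the least degree of a nonzero graded component of the canonical module of `K[𝒜]`
is `1`, so `a(K[𝒜]) = -1`. -/
theorem min_degree_canonical_module_of_add_le
    (n i j : ℕ) (hn : 3 ≤ n) (hi1 : 1 ≤ i) (hi2 : i ≤ n - 2)
    (hj1 : 1 ≤ j) (hj2 : j ≤ n - 1) (hij : i + j ≤ n - 1)
    (A : Set (Fin n → ℕ))
    (hA : A = { x | ∃ f : Fin n → Fin n,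
        (∀ k : Fin n, (i ≤ k.val ∧ k.val < i + j) → i ≤ (f k).val) ∧
        ∀ m : Fin n, x m = (Finset.univ.filter (fun k => f k = m)).card }) :
    IsLeast { d : ℕ | ∃ β : Fin n → ℕ, β ∈ AddSubmonoid.closure A ∧ (∀ k, 1 ≤ β k) ∧
        0 < -(j : ℤ) * (∑ k ∈ Finset.univ.filter (fun k : Fin n => k.val < i), (β k : ℤ))
            + ((n : ℤ) - j) * (∑ k ∈ Finset.univ.filter (fun k : Fin n => i ≤ k.val), (β k : ℤ)) ∧
        (∑ k, β k) = d } n := by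
  constructor
  · refine ⟨fun _ => 1, AddSubmonoid.subset_closure ?_, fun _ => le_rfl, ?_, by simp⟩
    · rw [hA]
      refine ⟨id, fun k hk => hk.1, fun m => ?_⟩
      simp [Finset.filter_eq']
    · have hlt : (Finset.univ.filter (fun k : Fin n => k.val < i)).card = i := by
        rw [Fin.card_filter_val_lt]
        omega
      have hge : (Finset.univ.filter (fun k : Fin n => i ≤ k.val)).card = n - i := by
        have h := Finset.card_filter_add_card_filter_not
          (s := (Finset.univ : Finset (Fin n))) (fun k : Fin n => k.val < i)
        simp only [not_lt, Finset.card_univ, Fintype.card_fin, hlt] at h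
        omega
      simp only [Nat.cast_one, Finset.sum_const, hlt, hge, nsmul_eq_mul, mul_one]
      rw [Nat.cast_sub (by omega : i ≤ n)]
      have hpos : (0 : ℤ) < n * ((n : ℤ) - i - j) := mul_pos (by omega) (by omega)
      linarith
  · rintro d ⟨β, -, hβ, -, rfl⟩
    simpa using Finset.card_nsmul_le_sum Finset.univ β 1 fun k _ => hβ k
end
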